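/- arXiv:2106.09247 — 2 statements merged into one kernel-verified Lean document; each statement's English description precedes it below -/
import Mathlib

section
/- Let F be a field of characteristic zero and let n = 9. Let K = F(c_1,…,c_9) and let p(X) = X^9 + c_1 X^{8} + ⋯ + c_9 ∈ K[X] be the general equation of degree 9. Then there exist a field extension L of K obtainable by auxiliary equations of degree ≤ 5 and elements a_0, a_1, …, a_8 ∈ L with (a_1,…,a_8) ≠ 0 such that, in a splitting field of p over L with roots x_1,…,x_9, the Tschirnhaus transform ∏_{i=1}^9 (Y − (a_0 + a_1 x_i + ⋯ + a_8 x_i^{8})) has vanishing coefficients in degrees Y^{8}, Y^{7}, Y^{6} and Y^{5}; i.e., it has the form Y^9 + C_5 Y^{4} + C_6 Y^3 + C_7 Y^2 + C_8 Y + C_9. -/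
open Polynomial

/-- A field extension `L/K` is *obtainable by auxiliary equations of degree at most `m`*
if there is a tower `K = L₀ ⊆ L₁ ⊆ ⋯ ⊆ L_r = L` of intermediate fields with
`[L_{i+1} : L_i] ≤ m` for each `i`. -/
def ObtainableByAuxDegLE (K L : Type*) [Field K] [Field L] [Algebra K L] (m : ℕ) : Prop :=
  ∃ (r : ℕ) (T : Fin (r + 1) → IntermediateField K L),
    T 0 = ⊥ ∧ T (Fin.last r) = ⊤ ∧
    ∀ i : Fin r, ∃ h : T i.castSucc ≤ T i.succ,
      Module.rank (T i.castSucc) (IntermediateField.extendScalars h) ≤ m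

section

open Module

/-- Every polynomial of degree between `1` and `5` over `E` has a root in `E`. -/
def QuinticClosed (E : Type*) [Field E] : Prop :=
  ∀ f : E[X], 0 < f.natDegree → f.natDegree ≤ 5 → ∃ x, f.IsRoot x

namespace QuinticClosed

variable {E : Type*} [Field E]

theorem exists_sq_eq (hE : QuinticClosed E) (a : E) : ∃ x : E, x ^ 2 = a := by
  have hd : (X ^ 2 - C a : E[X]).natDegree = 2 := natDegree_X_pow_sub_C
  obtain ⟨x, hx⟩ := hE (X ^ 2 - C a) (by omega) (by omega)
  exact ⟨x, by simpa [sub_eq_zero] using hx⟩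

theorem exists_binary_form_eq_zero (hE : QuinticClosed E) (d : ℕ) (h0 : 0 < d) (h5 : d ≤ 5)
    (c : ℕ → E) :
    ∃ s t : E, (s ≠ 0 ∨ t ≠ 0) ∧
      ∑ i ∈ Finset.range (d + 1), c i * s ^ i * t ^ (d - i) = 0 := by
  by_cases hc : c d = 0
  · refine ⟨1, 0, by simp, Finset.sum_eq_zero fun i hi => ?_⟩
    rcases eq_or_ne i d with rfl | hid
    · simp [hc]
    · have : d - i ≠ 0 := by have := Finset.mem_range.1 hi; omega
      simp [this]
  · set f : E[X] := ∑ i ∈ Finset.range (d + 1), C (c i) * X ^ i with hf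
    have hcoeff : f.coeff d = c d := by simp [hf, coeff_C_mul, coeff_X_pow]
    have hle : f.natDegree ≤ d := natDegree_sum_le_of_forall_le _ _ fun i hi =>
      (natDegree_C_mul_X_pow_le _ _).trans (by have := Finset.mem_range.1 hi; omega)
    have hge : d ≤ f.natDegree := le_natDegree_of_ne_zero (hcoeff ▸ hc)
    obtain ⟨x, hx⟩ := hE f (by omega) (by omega)
    refine ⟨x, 1, by simp, ?_⟩
    simpa [hf, IsRoot.def, eval_finsetSum] using hx

theorem exists_binary_quadratic_eq_zero (hE : QuinticClosed E) (a b c : E) :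
    ∃ s t : E, (s ≠ 0 ∨ t ≠ 0) ∧ a * s ^ 2 + b * (s * t) + c * t ^ 2 = 0 := by
  obtain ⟨s, t, hst, h⟩ := hE.exists_binary_form_eq_zero 2 (by simp) (by simp)
    (fun i => if i = 2 then a else if i = 1 then b else c)
  refine ⟨s, t, hst, ?_⟩
  simp [Finset.sum_range_succ] at h
  linear_combination h

theorem exists_binary_cubic_eq_zero (hE : QuinticClosed E) (a b c d : E) :
    ∃ s t : E, (s ≠ 0 ∨ t ≠ 0) ∧
      a * s ^ 3 + b * (s ^ 2 * t) + c * (s * t ^ 2) + d * t ^ 3 = 0 := by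
  obtain ⟨s, t, hst, h⟩ := hE.exists_binary_form_eq_zero 3 (by simp) (by simp)
    (fun i => if i = 3 then a else if i = 2 then b else if i = 1 then c else d)
  refine ⟨s, t, hst, ?_⟩
  simp [Finset.sum_range_succ] at h
  linear_combination h

theorem exists_binary_quartic_eq_zero (hE : QuinticClosed E) (a b c d e : E) :
    ∃ s t : E, (s ≠ 0 ∨ t ≠ 0) ∧
      a * s ^ 4 + b * (s ^ 3 * t) + c * (s ^ 2 * t ^ 2) + d * (s * t ^ 3) + e * t ^ 4 = 0 := by
  obtain ⟨s, t, hst, h⟩ := hE.exists_binary_form_eq_zero 4 (by simp) (by simp)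
    (fun i => if i = 4 then a else if i = 3 then b else if i = 2 then c else
      if i = 1 then d else e)
  refine ⟨s, t, hst, ?_⟩
  simp [Finset.sum_range_succ] at h
  linear_combination h

theorem exists_det_pencil_eq_zero (hE : QuinticClosed E) {n : ℕ} (h0 : 0 < n) (h5 : n ≤ 5)
    (A B : Matrix (Fin n) (Fin n) E) :
    ∃ s t : E, (s ≠ 0 ∨ t ≠ 0) ∧ (s • A + t • B).det = 0 := by
  by_cases hA : A.det = 0
  · exact ⟨1, 0, by simp, by simp [hA]⟩
  · set f : E[X] := ((X : E[X]) • A.map C + B.map C).det with hf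
    have hcoeff : f.coeff n = A.det := by simpa using coeff_det_X_add_C_card A B
    have hle : f.natDegree ≤ n := by simpa using natDegree_det_X_add_C_le A B
    have hge : n ≤ f.natDegree := le_natDegree_of_ne_zero (hcoeff ▸ hA)
    obtain ⟨x, hx⟩ := hE f (by omega) (by omega)
    refine ⟨x, 1, by simp, ?_⟩
    rw [IsRoot.def, hf, ← coe_evalRingHom, RingHom.map_det] at hx
    rw [← hx]
    congr 1
    ext i j
    simpa using mul_comm x (A i j)

end QuinticClosed

section Linear

variable {E : Type*} [Field E] {V : Type*} [AddCommGroup V] [Module E V]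

theorem exists_submodule_finrank_eq_of_le {n : ℕ} (h : n ≤ finrank E V) :
    ∃ S : Submodule E V, finrank E S = n := by
  obtain ⟨b, hb⟩ := exists_linearIndependent_of_le_finrank h
  exact ⟨Submodule.span E (Set.range b), by simpa using finrank_span_eq_card hb⟩

/-- The common kernel of `n` functionals has codimension at most `n`. -/
theorem exists_submodule_of_functionals [FiniteDimensional E V] {n : ℕ}
    (f : Fin n → V →ₗ[E] E) :
    ∃ S : Submodule E V, finrank E V ≤ finrank E S + n ∧ ∀ x ∈ S, ∀ i, f i x = 0 := by
  refine ⟨LinearMap.ker (LinearMap.pi f), ?_, fun x hx => congrFun (LinearMap.mem_ker.1 hx)⟩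
  have h1 := LinearMap.finrank_range_add_finrank_ker (LinearMap.pi f)
  have h2 := Submodule.finrank_le (LinearMap.range (LinearMap.pi f))
  rw [finrank_fin_fun] at h2
  omega

theorem LinearIndependent.pair_of_functional (f : V →ₗ[E] E) {v u : V} (hv : f v ≠ 0)
    (hu : f u = 0) (hu0 : u ≠ 0) : LinearIndependent E ![v, u] := by
  rw [LinearIndependent.pair_iff]
  intro s t h
  have hs : s = 0 := by simpa [hu, hv] using congrArg f h
  refine ⟨hs, ?_⟩
  simpa [hs, hu0] using h

theorem LinearIndependent.pair_combination_ne_zero {v u : V} (h : LinearIndependent E ![v, u])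
    {s t : E} (hst : s ≠ 0 ∨ t ≠ 0) : s • v + t • u ≠ 0 := by
  intro h0
  have := LinearIndependent.pair_iff.1 h s t h0
  tauto

end Linear

namespace QuinticClosed

variable {E : Type*} [Field E] {V : Type*} [AddCommGroup V] [Module E V]

/-- A member of a pencil of bilinear forms in at most five dimensions is degenerate. -/
theorem exists_pencil_radical (hE : QuinticClosed E) [FiniteDimensional E V]
    (h0 : 0 < finrank E V) (h5 : finrank E V ≤ 5) (B₁ B₂ : LinearMap.BilinForm E V) :
    ∃ s t : E, (s ≠ 0 ∨ t ≠ 0) ∧ ∃ v : V, v ≠ 0 ∧ ∀ w, s * B₁ w v + t * B₂ w v = 0 := by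
  let b := finBasis E V
  obtain ⟨s, t, hst, hdet⟩ := hE.exists_det_pencil_eq_zero h0 h5
    (LinearMap.BilinForm.toMatrix b B₁) (LinearMap.BilinForm.toMatrix b B₂)
  refine ⟨s, t, hst, ?_⟩
  obtain ⟨c, hc, hmul⟩ := Matrix.exists_mulVec_eq_zero_iff.2 hdet
  refine ⟨∑ i, c i • b i, fun h => hc ?_, fun w => ?_⟩
  · exact funext fun i => Fintype.linearIndependent_iff.1 b.linearIndependent c h i
  · have key : (s • B₁ + t • B₂).flip (∑ i, c i • b i) = 0 := by
      refine b.ext fun i => ?_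
      have := congrFun hmul i
      simp only [Matrix.mulVec, dotProduct, Matrix.add_apply, Matrix.smul_apply,
        LinearMap.BilinForm.toMatrix_apply, Pi.zero_apply, smul_eq_mul] at this
      change (s • B₁ + t • B₂) (b i) (∑ i, c i • b i) = 0
      rw [map_sum, ← this]
      exact Finset.sum_congr rfl fun j _ => by simp; ring
    exact LinearMap.congr_fun key w

/-- A reduction for statements about the common zeros of a pencil of symmetric forms: one may
assume that the first form is degenerate. -/
theorem exists_degenerate_of_pencil (hE : QuinticClosed E) [FiniteDimensional E V]
    (h0 : 0 < finrank E V) (h5 : finrank E V ≤ 5) (B₁ B₂ : LinearMap.BilinForm E V)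
    (h₁ : ∀ x y, B₁ x y = B₁ y x) (h₂ : ∀ x y, B₂ x y = B₂ y x) :
    ∃ q q' : LinearMap.BilinForm E V, (∀ x y, q x y = q y x) ∧ (∀ x y, q' x y = q' y x) ∧
      (∃ v : V, v ≠ 0 ∧ ∀ w, q v w = 0) ∧
      ∀ x y, q x y = 0 → q' x y = 0 → B₁ x y = 0 ∧ B₂ x y = 0 := by
  obtain ⟨s, t, hst, v, hv, hrad⟩ := hE.exists_pencil_radical h0 h5 B₁ B₂
  have hsymm : ∀ x y, (s • B₁ + t • B₂) x y = (s • B₁ + t • B₂) y x := fun x y => by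
    simp [h₁ x y, h₂ x y]
  have hr : ∀ w, (s • B₁ + t • B₂) v w = 0 := fun w => by
    rw [hsymm]; simpa using hrad w
  by_cases hs : s = 0
  · have ht : t ≠ 0 := by tauto
    refine ⟨s • B₁ + t • B₂, B₁, hsymm, h₁, ⟨v, hv, hr⟩, fun x y hq hq' => ⟨hq', ?_⟩⟩
    simpa [hs, ht] using hq
  · refine ⟨s • B₁ + t • B₂, B₂, hsymm, h₂, ⟨v, hv, hr⟩, fun x y hq hq' => ⟨?_, hq'⟩⟩
    simpa [hs, hq'] using hq

theorem exists_isotropic_combination (hE : QuinticClosed E) (B : LinearMap.BilinForm E V)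
    (u w : V) : ∃ s t : E, (s ≠ 0 ∨ t ≠ 0) ∧ B (s • u + t • w) (s • u + t • w) = 0 := by
  obtain ⟨s, t, hst, h⟩ := hE.exists_binary_quadratic_eq_zero (B u u) (B u w + B w u) (B w w)
  refine ⟨s, t, hst, ?_⟩
  simp only [map_add, map_smul, LinearMap.add_apply, LinearMap.smul_apply, smul_eq_mul]
  linear_combination h

theorem exists_isotropic (hE : QuinticClosed E) [FiniteDimensional E V]
    (h : 2 ≤ finrank E V) (B : LinearMap.BilinForm E V) : ∃ v : V, v ≠ 0 ∧ B v v = 0 := by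
  obtain ⟨b, hb⟩ := exists_linearIndependent_of_le_finrank h
  have hb' : LinearIndependent E ![b 0, b 1] := by
    convert hb using 1
    ext i; fin_cases i <;> rfl
  obtain ⟨s, t, hst, h⟩ := hE.exists_isotropic_combination B (b 0) (b 1)
  exact ⟨_, hb'.pair_combination_ne_zero hst, h⟩

theorem exists_isotropic_plane (hE : QuinticClosed E) [FiniteDimensional E V]
    (h : 4 ≤ finrank E V) (B : LinearMap.BilinForm E V) :
    ∃ u w : V, LinearIndependent E ![u, w] ∧ B u u = 0 ∧ B u w = 0 ∧ B w w = 0 := by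
  obtain ⟨v, hv, hvv⟩ := hE.exists_isotropic (by omega) B
  obtain ⟨φ, hφ⟩ := Module.Projective.exists_dual_ne_zero E hv
  obtain ⟨S, hS, hmem⟩ := exists_submodule_of_functionals ![φ, B v]
  obtain ⟨u, hu, huu⟩ := hE.exists_isotropic (V := S) (by omega) (B.restrict S)
  refine ⟨v, u, .pair_of_functional φ hφ (hmem u u.2 0) (by simpa using hu), hvv,
    hmem u u.2 1, by simpa using huu⟩

/-- Two conics have a common point. -/
theorem exists_common_isotropic (hE : QuinticClosed E) [FiniteDimensional E V]
    (h : 3 ≤ finrank E V) (B₁ B₂ : LinearMap.BilinForm E V)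
    (h₁ : ∀ x y, B₁ x y = B₁ y x) (h₂ : ∀ x y, B₂ x y = B₂ y x) :
    ∃ v : V, v ≠ 0 ∧ B₁ v v = 0 ∧ B₂ v v = 0 := by
  obtain ⟨T, hT⟩ := exists_submodule_finrank_eq_of_le h
  obtain ⟨q, q', hq, hq', ⟨v, hv, hrad⟩, hzero⟩ := hE.exists_degenerate_of_pencil (V := T)
    (by omega) (by omega) (B₁.restrict T) (B₂.restrict T) (fun x y => h₁ x y) (fun x y => h₂ x y)
  obtain ⟨φ, hφ⟩ := Module.Projective.exists_dual_ne_zero E hv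
  obtain ⟨S, hS, hmem⟩ := exists_submodule_of_functionals ![φ]
  obtain ⟨u, hu, huu⟩ := hE.exists_isotropic (V := S) (by omega) (q.restrict S)
  have hind : LinearIndependent E ![v, (u : T)] :=
    .pair_of_functional φ hφ (hmem u u.2 0) (by simpa using hu)
  obtain ⟨s, t, hst, hz⟩ := hE.exists_isotropic_combination q' v u
  have huu' : q (u : T) (u : T) = 0 := huu
  have hz' : q (s • v + t • (u : T)) (s • v + t • (u : T)) = 0 := by
    simp [hrad, hq u v, huu']
  obtain ⟨hz₁, hz₂⟩ := hzero _ _ hz' hz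
  refine ⟨(s • v + t • (u : T) : T), ?_, hz₁, hz₂⟩
  simpa only [ne_eq, ZeroMemClass.coe_eq_zero] using hind.pair_combination_ne_zero hst

/-- A nondegenerate quadratic form in at least four variables restricts to the sum of two
hyperbolic planes. -/
theorem exists_two_hyperbolic_planes [CharZero E] (hE : QuinticClosed E) [FiniteDimensional E V]
    (h : 4 ≤ finrank E V) (q : LinearMap.BilinForm E V) (hq : ∀ x y, q x y = q y x)
    (hrad : ∀ v : V, v ≠ 0 → ∃ w, q v w ≠ 0) :
    ∃ e₁ e₂ f₁ f₂ : V, LinearIndependent E ![e₁, e₂, f₁, f₂] ∧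
      q e₁ e₁ = 0 ∧ q e₁ e₂ = 0 ∧ q e₂ e₂ = 0 ∧ q f₁ f₁ = 0 ∧ q f₁ f₂ = 0 ∧
        q f₂ f₂ = 0 ∧ q e₁ f₂ = 0 ∧ q e₂ f₁ = 0 ∧ q e₁ f₁ = q e₂ f₂ := by
  let _ : Invertible (2 : E) := invertibleOfNonzero two_ne_zero
  obtain ⟨b, hb⟩ := LinearMap.BilinForm.exists_orthogonal_basis (B := q) ⟨fun x y => hq x y⟩
  have hb0 : ∀ i j, i ≠ j → q (b i) (b j) = 0 := fun i j hij => hb hij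
  have hdiag : ∀ i, q (b i) (b i) ≠ 0 := fun i hi => by
    obtain ⟨w, hw⟩ := hrad (b i) (b.ne_zero i)
    have hzero : q (b i) = 0 := b.ext fun j => by
      rcases eq_or_ne i j with rfl | hij
      · simpa using hi
      · simpa using hb0 i j hij
    exact hw (by simp [hzero])
  choose r hr using fun i => hE.exists_sq_eq (q (b i) (b i))
  have hr0 : ∀ i, r i ≠ 0 := fun i hi => hdiag i (by rw [← hr i, hi]; simp)
  obtain ⟨I, hI⟩ := hE.exists_sq_eq (-1)
  have hI0 : I ≠ 0 := by rintro rfl; simp at hI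
  let e : Fin 4 → V := fun i => (r (i.castLE h))⁻¹ • b (i.castLE h)
  have heind : LinearIndependent E e :=
    (b.linearIndependent.comp (Fin.castLE h) (Fin.castLE_injective h)).units_smul
      fun i => (Units.mk0 _ (hr0 (i.castLE h)))⁻¹
  have hediag : ∀ i, q (e i) (e i) = 1 := fun i => by
    have := hr0 (i.castLE h)
    simp only [e, map_smul, LinearMap.smul_apply, smul_eq_mul, ← hr (i.castLE h)]
    field_simp
  have heoff : ∀ i j, i ≠ j → q (e i) (e j) = 0 := fun i j hij => by
    simp [e, hb0 _ _ fun h' => hij (Fin.castLE_injective h h')]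
  obtain ⟨e₁, he₁⟩ : ∃ x, x = e 0 + I • e 1 := ⟨_, rfl⟩
  obtain ⟨e₂, he₂⟩ : ∃ x, x = e 2 + I • e 3 := ⟨_, rfl⟩
  obtain ⟨f₁, hf₁⟩ : ∃ x, x = e 0 - I • e 1 := ⟨_, rfl⟩
  obtain ⟨f₂, hf₂⟩ : ∃ x, x = e 2 - I • e 3 := ⟨_, rfl⟩
  have hee : q e₁ e₁ = 0 ∧ q e₁ e₂ = 0 ∧ q e₂ e₂ = 0 ∧ q f₁ f₁ = 0 ∧ q f₁ f₂ = 0 ∧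
      q f₂ f₂ = 0 ∧ q e₁ f₂ = 0 ∧ q e₂ f₁ = 0 ∧ q e₁ f₁ = q e₂ f₂ := by
    simp only [he₁, he₂, hf₁, hf₂, map_add, map_sub, map_smul, LinearMap.add_apply,
      LinearMap.sub_apply, LinearMap.smul_apply, smul_eq_mul, hediag,
      heoff 0 1 (by decide), heoff 0 2 (by decide), heoff 0 3 (by decide),
      heoff 1 0 (by decide), heoff 1 2 (by decide), heoff 1 3 (by decide),
      heoff 2 0 (by decide), heoff 2 1 (by decide), heoff 2 3 (by decide),
      heoff 3 0 (by decide), heoff 3 1 (by decide), heoff 3 2 (by decide)]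
    refine ⟨?_, ?_, ?_, ?_, ?_, ?_, ?_, ?_, ?_⟩ <;> first | trivial | ring1 | linear_combination hI
  refine ⟨e₁, e₂, f₁, f₂, ?_, hee⟩
  rw [Fintype.linearIndependent_iff] at heind ⊢
  intro g hg
  simp only [Fin.sum_univ_four, Matrix.cons_val, he₁, he₂, hf₁, hf₂] at hg
  have hc := heind ![g 0 + g 2, I * (g 0 - g 2), g 1 + g 3, I * (g 1 - g 3)] (by
    rw [← hg]
    simp only [Fin.sum_univ_four, Matrix.cons_val]
    module)
  have c0 : g 0 + g 2 = 0 := hc 0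
  have c1 : I * (g 0 - g 2) = 0 := hc 1
  have c2 : g 1 + g 3 = 0 := hc 2
  have c3 : I * (g 1 - g 3) = 0 := hc 3
  replace c1 : g 0 - g 2 = 0 := by simpa [hI0] using c1
  replace c3 : g 1 - g 3 = 0 := by simpa [hI0] using c3
  have two : (2 : E) ≠ 0 := two_ne_zero
  intro i
  fin_cases i <;> refine mul_left_cancel₀ two ?_
  · change 2 * g 0 = 2 * 0
    linear_combination c0 + c1
  · change 2 * g 1 = 2 * 0
    linear_combination c2 + c3
  · change 2 * g 2 = 2 * 0
    linear_combination c0 - c1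
  · change 2 * g 3 = 2 * 0
    linear_combination c2 - c3

/-- A quadric surface contains a line which is tangent to a second given quadric. -/
theorem exists_tangent_isotropic_plane [CharZero E] (hE : QuinticClosed E) [FiniteDimensional E V]
    (h : 4 ≤ finrank E V) (q q' : LinearMap.BilinForm E V)
    (hq : ∀ x y, q x y = q y x) (hq' : ∀ x y, q' x y = q' y x) :
    ∃ u w : V, LinearIndependent E ![u, w] ∧ q u u = 0 ∧ q u w = 0 ∧ q w w = 0 ∧
      q' u u * q' w w = q' u w ^ 2 := by
  by_cases hrad : ∃ v : V, v ≠ 0 ∧ ∀ w, q v w = 0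
  · obtain ⟨v, hv, hrad⟩ := hrad
    obtain ⟨φ, hφ⟩ := Module.Projective.exists_dual_ne_zero E hv
    obtain ⟨S, hS, hmem⟩ := exists_submodule_of_functionals ![φ]
    let D : LinearMap.BilinForm E V := q' v v • q' - (LinearMap.mul E E).compl₁₂ (q' v) (q' v)
    have hD : ∀ x y, D x y = q' v v * q' x y - q' v x * q' v y := fun x y => by simp [D]
    obtain ⟨u, hu, huu, hDu⟩ := hE.exists_common_isotropic (V := S) (by omega)
      (q.restrict S) (D.restrict S) (fun x y => hq x y)
      (fun x y => by
        change D x y = D y x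
        rw [hD, hD, hq' x y]; ring)
    replace hDu : D u u = 0 := hDu
    rw [hD] at hDu
    exact ⟨v, u, .pair_of_functional φ hφ (hmem u u.2 0) (by simpa using hu), hrad v, hrad u, huu,
      by linear_combination hDu⟩
  · push Not at hrad
    obtain ⟨e₁, e₂, f₁, f₂, hind, h₁, h₂, h₃, h₄, h₅, h₆, h₇, h₈, h₉⟩ :=
      hE.exists_two_hyperbolic_planes h q hq hrad
    obtain ⟨s, t, hst, hdisc⟩ := hE.exists_binary_quartic_eq_zero
      (q' e₁ e₁ * q' f₂ f₂ - q' e₁ f₂ ^ 2)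
      (2 * q' e₁ e₂ * q' f₂ f₂ - 2 * q' e₁ e₁ * q' f₁ f₂ - 2 * q' e₁ f₂ * (q' e₂ f₂ - q' e₁ f₁))
      (q' e₂ e₂ * q' f₂ f₂ - 4 * q' e₁ e₂ * q' f₁ f₂ + q' e₁ e₁ * q' f₁ f₁
        - (q' e₂ f₂ - q' e₁ f₁) ^ 2 + 2 * q' e₁ f₂ * q' e₂ f₁)
      (2 * q' e₁ e₂ * q' f₁ f₁ - 2 * q' e₂ e₂ * q' f₁ f₂ + 2 * q' e₂ f₁ * (q' e₂ f₂ - q' e₁ f₁))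
      (q' e₂ e₂ * q' f₁ f₁ - q' e₂ f₁ ^ 2)
    refine ⟨s • e₁ + t • e₂, s • f₂ - t • f₁, ?_, ?_, ?_, ?_, ?_⟩
    · rw [LinearIndependent.pair_iff]
      intro α β hαβ
      have hc := Fintype.linearIndependent_iff.1 hind ![α * s, α * t, -(β * t), β * s] (by
        rw [← hαβ]
        simp only [Fin.sum_univ_four, Matrix.cons_val]
        module)
      have c0 : α * s = 0 := hc 0
      have c1 : α * t = 0 := hc 1
      have c2 : -(β * t) = 0 := hc 2
      have c3 : β * s = 0 := hc 3
      rcases hst with hs | ht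
      · simp_all
      · simp_all
    all_goals
      simp only [map_add, map_sub, map_smul, LinearMap.add_apply, LinearMap.sub_apply,
        LinearMap.smul_apply, smul_eq_mul]
    · rw [hq e₂ e₁, h₁, h₂, h₃]; ring
    · rw [h₇, h₈, h₉]; ring
    · rw [hq f₂ f₁, h₄, h₅, h₆]; ring
    · rw [hq' e₂ e₁, hq' f₂ f₁]
      linear_combination hdisc

/-- Two quadrics in projective four-space have a common line. -/
theorem exists_common_isotropic_plane [CharZero E] (hE : QuinticClosed E) [FiniteDimensional E V]
    (h : 5 ≤ finrank E V) (B₁ B₂ : LinearMap.BilinForm E V)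
    (h₁ : ∀ x y, B₁ x y = B₁ y x) (h₂ : ∀ x y, B₂ x y = B₂ y x) :
    ∃ u w : V, LinearIndependent E ![u, w] ∧ B₁ u u = 0 ∧ B₁ u w = 0 ∧ B₁ w w = 0 ∧
      B₂ u u = 0 ∧ B₂ u w = 0 ∧ B₂ w w = 0 := by
  obtain ⟨T, hT⟩ := exists_submodule_finrank_eq_of_le h
  obtain ⟨q, q', hq, hq', ⟨v, hv, hrad⟩, hzero⟩ := hE.exists_degenerate_of_pencil (V := T)
    (by omega) (by omega) (B₁.restrict T) (B₂.restrict T) (fun x y => h₁ x y) (fun x y => h₂ x y)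
  have hrad' : ∀ w, q w v = 0 := fun w => by rw [hq, hrad]
  suffices hs : ∃ u w : T, LinearIndependent E ![u, w] ∧ q u u = 0 ∧ q u w = 0 ∧ q w w = 0 ∧
      q' u u = 0 ∧ q' u w = 0 ∧ q' w w = 0 by
    obtain ⟨u, w, hind, h1, h2, h3, h4, h5, h6⟩ := hs
    refine ⟨u, w, ?_, (hzero _ _ h1 h4).1, (hzero _ _ h2 h5).1, (hzero _ _ h3 h6).1,
      (hzero _ _ h1 h4).2, (hzero _ _ h2 h5).2, (hzero _ _ h3 h6).2⟩
    rw [LinearIndependent.pair_iff] at hind ⊢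
    exact fun s t hst => hind s t (Subtype.ext hst)
  by_cases hvv : q' v v = 0
  · obtain ⟨φ, hφ⟩ := Module.Projective.exists_dual_ne_zero E hv
    obtain ⟨S, hS, hmem⟩ := exists_submodule_of_functionals ![φ, q' v]
    obtain ⟨u, hu, huq, huq'⟩ := hE.exists_common_isotropic (V := S) (by omega)
      (q.restrict S) (q'.restrict S) (fun x y => hq x y) (fun x y => hq' x y)
    exact ⟨v, u, .pair_of_functional φ hφ (hmem u u.2 0) (by simpa using hu),
      hrad v, hrad u, huq, hvv, hmem u u.2 1, huq'⟩
  · obtain ⟨S, hS, hmem⟩ := exists_submodule_of_functionals ![q' v]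
    obtain ⟨u, w, hind, huu, huw, hww, hdisc⟩ := hE.exists_tangent_isotropic_plane (V := S)
      (by omega) (q.restrict S) (q'.restrict S) (fun x y => hq x y) (fun x y => hq' x y)
    replace huu : q (u : T) u = 0 := huu
    replace huw : q (u : T) w = 0 := huw
    replace hww : q (w : T) w = 0 := hww
    replace hdisc : q' (u : T) u * q' (w : T) w = q' (u : T) w ^ 2 := hdisc
    have hu : q' v u = 0 := hmem u u.2 0
    have hw : q' v w = 0 := hmem w w.2 0
    have hu' : q' u v = 0 := by rw [hq', hu]
    have hw' : q' w v = 0 := by rw [hq', hw]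
    obtain ⟨α, β, hα, hαβ, hβ⟩ : ∃ α β : E, q' (u : T) u + α ^ 2 * q' v v = 0 ∧
        q' (u : T) w + α * β * q' v v = 0 ∧ q' (w : T) w + β ^ 2 * q' v v = 0 := by
      obtain ⟨α, hα⟩ := hE.exists_sq_eq (-(q' (u : T) u) / q' v v)
      rw [eq_div_iff hvv] at hα
      by_cases hα0 : α = 0
      · obtain ⟨β, hβ⟩ := hE.exists_sq_eq (-(q' (w : T) w) / q' v v)
        rw [eq_div_iff hvv] at hβ
        have h0 : q' (u : T) u = 0 := by
          rw [hα0] at hα; linear_combination hα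
        rw [h0, zero_mul, eq_comm] at hdisc
        have h1 : q' (u : T) w = 0 := by simpa using hdisc
        exact ⟨0, β, by simp [h0], by simp [h1], by linear_combination hβ⟩
      · have hα2 : α ^ 2 * q' v v ≠ 0 := mul_ne_zero (pow_ne_zero 2 hα0) hvv
        refine ⟨α, -(q' (u : T) w) / (α * q' v v), by linear_combination hα, ?_, ?_⟩
        · field_simp; ring
        · refine mul_left_cancel₀ hα2 ?_
          field_simp
          linear_combination q' (w : T) w * hα - hdisc
    refine ⟨u + α • v, w + β • v, ?_, ?_⟩
    · rw [LinearIndependent.pair_iff] at hind ⊢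
      intro s t hst
      have hv0 : s * α + t * β = 0 := by
        have := congrArg (q' v) hst
        simp only [map_add, map_smul, smul_eq_mul, hu, hw, map_zero] at this
        refine mul_right_cancel₀ hvv ?_
        linear_combination this
      refine hind s t (Subtype.ext ?_)
      calc s • (u : T) + t • (w : T)
          = s • ((u : T) + α • v) + t • ((w : T) + β • v) - (s * α + t * β) • v := by module
        _ = 0 := by rw [hst, hv0]; simp
    · simp only [map_add, map_smul, LinearMap.add_apply, LinearMap.smul_apply, smul_eq_mul,
        hrad, hrad', hu, hw, hu', hw', huu, huw, hww]
      refine ⟨by ring, by ring, by ring, ?_, ?_, ?_⟩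
      · linear_combination hα
      · linear_combination hαβ
      · linear_combination hβ

end QuinticClosed

namespace QuinticClosed

variable {E : Type*} [Field E] {A : Type*} [CommRing A] [Algebra E A]
  {V : Type*} [AddCommGroup V] [Module E V]

theorem exists_cubic_combination (hE : QuinticClosed E) (τ : A →ₗ[E] E) (x y : A) :
    ∃ s t : E, (s ≠ 0 ∨ t ≠ 0) ∧ τ ((s • x + t • y) ^ 3) = 0 := by
  obtain ⟨s, t, hst, h⟩ := hE.exists_binary_cubic_eq_zero (τ (x ^ 3)) (3 * τ (x ^ 2 * y))
    (3 * τ (x * y ^ 2)) (τ (y ^ 3))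
  refine ⟨s, t, hst, ?_⟩
  have : (s • x + t • y) ^ 3 = s ^ 3 • x ^ 3 + (3 * (s ^ 2 * t)) • (x ^ 2 * y)
      + (3 * (s * t ^ 2)) • (x * y ^ 2) + t ^ 3 • y ^ 3 := by
    simp only [Algebra.smul_def, map_mul, map_pow, map_ofNat]; ring
  rw [this]
  simp only [map_add, map_smul, smul_eq_mul]
  linear_combination h

theorem exists_quartic_combination (hE : QuinticClosed E) (τ : A →ₗ[E] E) (x y : A) :
    ∃ s t : E, (s ≠ 0 ∨ t ≠ 0) ∧ τ ((s • x + t • y) ^ 4) = 0 := by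
  obtain ⟨s, t, hst, h⟩ := hE.exists_binary_quartic_eq_zero (τ (x ^ 4)) (4 * τ (x ^ 3 * y))
    (6 * τ (x ^ 2 * y ^ 2)) (4 * τ (x * y ^ 3)) (τ (y ^ 4))
  refine ⟨s, t, hst, ?_⟩
  have : (s • x + t • y) ^ 4 = s ^ 4 • x ^ 4 + (4 * (s ^ 3 * t)) • (x ^ 3 * y)
      + (6 * (s ^ 2 * t ^ 2)) • (x ^ 2 * y ^ 2) + (4 * (s * t ^ 3)) • (x * y ^ 3)
      + t ^ 4 • y ^ 4 := by
    simp only [Algebra.smul_def, map_mul, map_pow, map_ofNat]; ring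
  rw [this]
  simp only [map_add, map_smul, smul_eq_mul]
  linear_combination h

theorem map_mul_combination_sq (τ : A →ₗ[E] E) (c x y : A) (s t : E) :
    τ (c * (s • x + t • y) ^ 2) =
      s ^ 2 * τ (c * (x * x)) + 2 * (s * t) * τ (c * (x * y)) + t ^ 2 * τ (c * (y * y)) := by
  have : c * (s • x + t • y) ^ 2 = s ^ 2 • (c * (x * x)) + (2 * (s * t)) • (c * (x * y))
      + t ^ 2 • (c * (y * y)) := by
    simp only [Algebra.smul_def, map_mul, map_pow, map_ofNat]; ring
  rw [this]
  simp only [map_add, map_smul, smul_eq_mul]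

/-- The form `(x, y) ↦ τ (c * (ι x * ι y))`. -/
def traceForm (τ : A →ₗ[E] E) (ι : V →ₗ[E] A) (c : A) : LinearMap.BilinForm E V :=
  ((LinearMap.mul E A).compl₁₂ ι ι).compr₂ (τ ∘ₗ LinearMap.mulLeft E c)

theorem traceForm_apply (τ : A →ₗ[E] E) (ι : V →ₗ[E] A) (c : A) (x y : V) :
    traceForm τ ι c x y = τ (c * (ι x * ι y)) := rfl

theorem traceForm_symm (τ : A →ₗ[E] E) (ι : V →ₗ[E] A) (c : A) (x y : V) :
    traceForm τ ι c x y = traceForm τ ι c y x := by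
  rw [traceForm_apply, traceForm_apply, mul_comm (ι x)]

/-- A quadric and a cubic in projective three-space have a common point. -/
theorem exists_quadratic_cubic_zero (hE : QuinticClosed E) [FiniteDimensional E V]
    (h : 4 ≤ finrank E V) (τ : A →ₗ[E] E) (ι : V →ₗ[E] A) :
    ∃ v : V, v ≠ 0 ∧ τ (ι v ^ 2) = 0 ∧ τ (ι v ^ 3) = 0 := by
  obtain ⟨u, w, hind, huu, huw, hww⟩ := hE.exists_isotropic_plane h (traceForm τ ι 1)
  rw [traceForm_apply] at huu huw hww
  obtain ⟨s, t, hst, h3⟩ := hE.exists_cubic_combination τ (ι u) (ι w)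
  refine ⟨_, hind.pair_combination_ne_zero hst, ?_, ?_⟩
  · have := map_mul_combination_sq τ 1 (ι u) (ι w) s t
    rw [huu, huw, hww, one_mul] at this
    simpa using this
  · simpa using h3

theorem exists_two_quadratics_cubic_zero [CharZero E] (hE : QuinticClosed E)
    [FiniteDimensional E V] (h : 5 ≤ finrank E V) (τ : A →ₗ[E] E) (ι : V →ₗ[E] A) (c : A) :
    ∃ v : V, v ≠ 0 ∧ τ (ι v ^ 2) = 0 ∧ τ (c * ι v ^ 2) = 0 ∧ τ (ι v ^ 3) = 0 := by
  obtain ⟨u, w, hind, h1, h2, h3, h4, h5, h6⟩ := hE.exists_common_isotropic_plane h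
    (traceForm τ ι 1) (traceForm τ ι c) (traceForm_symm τ ι 1) (traceForm_symm τ ι c)
  rw [traceForm_apply] at h1 h2 h3 h4 h5 h6
  obtain ⟨s, t, hst, hcub⟩ := hE.exists_cubic_combination τ (ι u) (ι w)
  refine ⟨_, hind.pair_combination_ne_zero hst, ?_, ?_, ?_⟩
  · have := map_mul_combination_sq τ 1 (ι u) (ι w) s t
    rw [h1, h2, h3, one_mul] at this
    simpa using this
  · have := map_mul_combination_sq τ c (ι u) (ι w) s t
    rw [h4, h5, h6] at this
    simpa using this
  · simpa using hcub

/-- In a nine-dimensional space of elements of a commutative algebra there is a nonzero element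
whose first four powers are annihilated by a given functional. -/
theorem exists_four_powers_zero [CharZero E] (hE : QuinticClosed E) [FiniteDimensional E V]
    (h : 9 ≤ finrank E V) (τ : A →ₗ[E] E) (ι : V →ₗ[E] A) :
    ∃ v : V, v ≠ 0 ∧ τ (ι v) = 0 ∧ τ (ι v ^ 2) = 0 ∧ τ (ι v ^ 3) = 0 ∧ τ (ι v ^ 4) = 0 := by
  obtain ⟨S, hS, hSmem⟩ := exists_submodule_of_functionals ![τ ∘ₗ ι]
  let κ : S →ₗ[E] A := ι ∘ₗ S.subtype
  obtain ⟨P, hP, hP2, hP3⟩ := hE.exists_quadratic_cubic_zero (by omega) τ κ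
  obtain ⟨φ, hφ⟩ := Module.Projective.exists_dual_ne_zero E hP
  obtain ⟨T, hT, hTmem⟩ := exists_submodule_of_functionals
    ![φ, τ ∘ₗ LinearMap.mulLeft E (κ P) ∘ₗ κ, τ ∘ₗ LinearMap.mulLeft E (κ P ^ 2) ∘ₗ κ]
  obtain ⟨R, hR, hR2, hPR2, hR3⟩ := hE.exists_two_quadratics_cubic_zero (V := T) (by omega) τ
    (κ ∘ₗ T.subtype) (κ P)
  simp only [LinearMap.comp_apply, Submodule.subtype_apply] at hR2 hPR2 hR3
  have hPR : τ (κ P * κ R) = 0 := hTmem R R.2 1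
  have hP2R : τ (κ P ^ 2 * κ R) = 0 := hTmem R R.2 2
  have hind : LinearIndependent E ![P, (R : S)] :=
    .pair_of_functional φ hφ (hTmem R R.2 0) (by simpa using hR)
  obtain ⟨s, t, hst, h4⟩ := hE.exists_quartic_combination τ (κ P) (κ R)
  have hne := hind.pair_combination_ne_zero hst
  have hval : ι (s • P + t • (R : S) : S) = s • κ P + t • κ R := by simp [κ]
  refine ⟨(s • P + t • (R : S) : S), by simpa only [ne_eq, ZeroMemClass.coe_eq_zero] using hne,
    hSmem _ (SetLike.coe_mem _) 0, ?_, ?_, ?_⟩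
  all_goals rw [hval]
  · have := map_mul_combination_sq τ 1 (κ P) (κ R) s t
    simp only [one_mul, ← pow_two, hP2, hPR, hR2] at this
    simpa using this
  · have : (s • κ P + t • κ R) ^ 3 = s ^ 3 • κ P ^ 3 + (3 * (s ^ 2 * t)) • (κ P ^ 2 * κ R)
        + (3 * (s * t ^ 2)) • (κ P * κ R ^ 2) + t ^ 3 • κ R ^ 3 := by
      simp only [Algebra.smul_def, map_mul, map_pow, map_ofNat]; ring
    rw [this]
    simp [hP3, hP2R, hPR2, hR3]
  · exact h4

end QuinticClosed

section Newton

theorem Multiset.esymm_eq_zero_of_power_sums {M : Type*} [Field M] [CharZero M] (s : Multiset M)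
    {k : ℕ} (hk : k ≠ 0) (h : ∀ j, 0 < j → j ≤ k → (s.map (· ^ j)).sum = 0) :
    s.esymm k = 0 := by
  obtain ⟨n, f, rfl⟩ : ∃ (n : ℕ) (f : Fin n → M), Finset.univ.val.map f = s := by
    refine ⟨s.toList.length, s.toList.get, ?_⟩
    rw [Fin.univ_val_map, List.ofFn_get, Multiset.coe_toList]
  have hN := congrArg (MvPolynomial.aeval f) (MvPolynomial.mul_esymm_eq_sum (Fin n) M k)
  rw [map_mul, map_mul, map_sum, Finset.sum_eq_zero, mul_zero,
    MvPolynomial.aeval_esymm_eq_multiset_esymm, map_natCast] at hN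
  · exact (mul_eq_zero.1 hN).resolve_left (Nat.cast_ne_zero.2 hk)
  · intro x hx
    obtain ⟨hx, hlt⟩ := Finset.mem_filter.1 hx
    have hsum := Finset.HasAntidiagonal.mem_antidiagonal.1 hx
    have := h x.2 (by omega) (by omega)
    rw [Multiset.map_map] at this
    rw [map_mul, MvPolynomial.psum, map_sum]
    simp only [map_pow, MvPolynomial.aeval_X]
    exact mul_eq_zero_of_right _ this

end Newton

section Tower

variable {K M : Type*} [Field K] [Field M] [Algebra K M]

/-- Intermediate fields obtained from `K` by successively adjoining roots of polynomials of
degree at most five. -/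
inductive IsQuinticTower : IntermediateField K M → Prop
  | bot : IsQuinticTower ⊥
  | adjoin {L : IntermediateField K M} (hL : IsQuinticTower L) (α : M) (f : M[X]) (hf : f ≠ 0)
      (hdeg : f.natDegree ≤ 5) (hcoeff : ∀ i, f.coeff i ∈ L) (hroot : f.IsRoot α) :
      IsQuinticTower (L ⊔ IntermediateField.adjoin K {α})

namespace IsQuinticTower

theorem sup {L L' : IntermediateField K M} (hL : IsQuinticTower L) (hL' : IsQuinticTower L') :
    IsQuinticTower (L ⊔ L') := by
  induction hL' with
  | bot => simpa using hL
  | adjoin _ α f hf hdeg hcoeff hroot ih =>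
    rw [← sup_assoc]
    exact ih.adjoin α f hf hdeg (fun i => (le_sup_right : _ ≤ L ⊔ _) (hcoeff i)) hroot

theorem relrank_adjoin_le (L : IntermediateField K M) (α : M) (f : M[X]) (hf : f ≠ 0)
    (hdeg : f.natDegree ≤ 5) (hcoeff : ∀ i, f.coeff i ∈ L) (hroot : f.IsRoot α) :
    L.relrank (L ⊔ IntermediateField.adjoin K {α}) ≤ 5 := by
  rw [IntermediateField.relrank_eq_rank_of_le le_sup_left]
  have hlift : f ∈ Polynomial.lifts (algebraMap L M) :=
    (Polynomial.lifts_iff_coeff_lifts f).2 fun i => ⟨⟨_, hcoeff i⟩, rfl⟩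
  obtain ⟨g, rfl⟩ := hlift
  rw [coe_mapRingHom] at *
  have hg : g ≠ 0 := fun h => hf (by simp [h])
  rw [natDegree_map] at hdeg
  have hga : aeval α g = 0 := by rwa [IsRoot, eval_map_algebraMap] at hroot
  have hαi : IsIntegral L α := isAlgebraic_iff_isIntegral.1 ⟨g, hg, hga⟩
  have hle : IntermediateField.extendScalars (le_sup_left : L ≤ L ⊔ IntermediateField.adjoin K {α})
      ≤ IntermediateField.adjoin L {α} := by
    rw [IntermediateField.extendScalars_le_iff]
    refine sup_le (fun x hx => ?_) ?_
    · exact (IntermediateField.adjoin L {α}).algebraMap_mem ⟨x, hx⟩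
    · rw [IntermediateField.adjoin_simple_le_iff]
      exact IntermediateField.mem_adjoin_simple_self L α
  have h1 := LinearMap.rank_le_of_injective (IntermediateField.inclusion hle).toLinearMap
    (IntermediateField.inclusion_injective hle)
  refine h1.trans ?_
  have := IntermediateField.adjoin.finiteDimensional hαi
  rw [← finrank_eq_rank, IntermediateField.adjoin.finrank hαi]
  exact_mod_cast (natDegree_le_of_dvd (minpoly.dvd _ _ hga) hg).trans hdeg

theorem exists_chain {L : IntermediateField K M} (hL : IsQuinticTower L) :
    ∃ (r : ℕ) (T : ℕ → IntermediateField K M), T 0 = ⊥ ∧ (∀ i, r ≤ i → T i = L) ∧ Monotone T ∧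
      ∀ i, (T i).relrank (T (i + 1)) ≤ 5 := by
  induction hL with
  | bot => exact ⟨0, fun _ => ⊥, rfl, fun _ _ => rfl, monotone_const, fun _ => by
      rw [IntermediateField.relrank_self]; norm_num⟩
  | @adjoin L _ α f hf hdeg hcoeff hroot ih =>
    obtain ⟨r, T, h0, hr, hmono, hrank⟩ := ih
    have hT : ∀ i ≤ r, T i ≤ L := fun i hi => hr r le_rfl ▸ hmono hi
    refine ⟨r + 1, fun i => if i ≤ r then T i else L ⊔ IntermediateField.adjoin K {α}, by simp [h0],
      fun i hi => if_neg (by omega), monotone_nat_of_le_succ fun i => ?_, fun i => ?_⟩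
    · split_ifs with h1 h2 h2
      · exact hmono (Nat.le_succ _)
      · exact (hT i h1).trans le_sup_left
      · omega
      · exact le_rfl
    · dsimp only
      split_ifs with h1 h2 h2
      · exact hrank i
      · rw [hr i (by omega)]
        exact relrank_adjoin_le L α f hf hdeg hcoeff hroot
      · omega
      · rw [IntermediateField.relrank_self]; norm_num

theorem obtainable {L : IntermediateField K M} (hL : IsQuinticTower L) :
    ObtainableByAuxDegLE K L 5 := by
  obtain ⟨r, T, hT0, hTr, hmono, hrank⟩ := hL.exists_chain
  have hle : ∀ i, T i ≤ L := fun i => by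
    rw [← hTr (max i r) (le_max_right _ _)]
    exact hmono (le_max_left _ _)
  refine ⟨r, fun i => (T i).comap L.val, ?_, ?_, fun i => ?_⟩
  · simp only [Fin.val_zero, hT0]
    refine eq_bot_iff.2 fun x hx => ?_
    obtain ⟨y, hy⟩ := IntermediateField.mem_bot.1
      (show (x : M) ∈ (⊥ : IntermediateField K M) from hx)
    exact IntermediateField.mem_bot.2 ⟨y, Subtype.ext hy⟩
  · refine eq_top_iff.2 fun x _ => ?_
    change (x : M) ∈ T r
    rw [hTr r le_rfl]
    exact x.2
  · have h : (T i).comap L.val ≤ (T (i + 1)).comap L.val := fun x hx => hmono (Nat.le_succ _) hx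
    refine ⟨h, ?_⟩
    have h2 := IntermediateField.relrank_comap_comap_eq_relrank_of_le (T i) (T (i + 1)) L.val
      (by rw [IntermediateField.fieldRange_val]; exact hle _)
    rw [IntermediateField.relrank_eq_rank_of_le h] at h2
    exact h2.trans_le (hrank i)

theorem directed : Directed (· ≤ ·)
    fun L : {L : IntermediateField K M // IsQuinticTower L} => (L : IntermediateField K M) :=
  fun L L' => ⟨⟨_, L.2.sup L'.2⟩, le_sup_left, le_sup_right⟩

variable (K M) in
/-- The union of all towers of equations of degree at most five. -/
def closure : IntermediateField K M :=
  ⨆ L : {L : IntermediateField K M // IsQuinticTower L}, L.1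

theorem mem_closure {x : M} :
    x ∈ closure K M ↔ ∃ L : IntermediateField K M, IsQuinticTower L ∧ x ∈ L := by
  have : Nonempty {L : IntermediateField K M // IsQuinticTower L} := ⟨⟨⊥, bot⟩⟩
  rw [← SetLike.mem_coe, closure, IntermediateField.coe_iSup_of_directed directed]
  simp

theorem exists_coeff_mem {f : M[X]} (hf : ∀ i, f.coeff i ∈ closure K M) :
    ∃ L : IntermediateField K M, IsQuinticTower L ∧ ∀ i, f.coeff i ∈ L := by
  suffices h : ∀ n, ∃ L : IntermediateField K M, IsQuinticTower L ∧ ∀ i < n, f.coeff i ∈ L by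
    obtain ⟨L, hL, h⟩ := h (f.natDegree + 1)
    refine ⟨L, hL, fun i => ?_⟩
    rcases lt_or_ge i (f.natDegree + 1) with hi | hi
    · exact h i hi
    · rw [coeff_eq_zero_of_natDegree_lt hi]
      exact L.zero_mem
  intro n
  induction n with
  | zero => exact ⟨⊥, bot, by simp⟩
  | succ n ih =>
    obtain ⟨L, hL, h⟩ := ih
    obtain ⟨L', hL', h'⟩ := mem_closure.1 (hf n)
    refine ⟨L ⊔ L', hL.sup hL', fun i hi => ?_⟩
    rcases Nat.lt_succ_iff_lt_or_eq.1 hi with hi | rfl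
    · exact (le_sup_left : L ≤ L ⊔ L') (h i hi)
    · exact (le_sup_right : L' ≤ L ⊔ L') h'

theorem quinticClosed_closure [IsAlgClosed M] : QuinticClosed (closure K M) := by
  intro f h0 h5
  set f' := f.map (algebraMap (closure K M) M) with hf'
  have hdeg : f'.natDegree = f.natDegree := natDegree_map _
  obtain ⟨L, hL, hc⟩ := exists_coeff_mem (f := f') fun i => by
    rw [hf', coeff_map]; exact (f.coeff i).2
  obtain ⟨α, hα⟩ := IsAlgClosed.exists_root f' fun h => by
    have := natDegree_eq_zero_iff_degree_le_zero.2 h.le; omega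
  have hne : f' ≠ 0 := fun h => by rw [h] at hdeg; simp at hdeg; omega
  have hmem : α ∈ closure K M := mem_closure.2 ⟨_, hL.adjoin α f' hne (by omega) hc hα,
    (le_sup_right : _ ≤ L ⊔ _) (IntermediateField.mem_adjoin_simple_self K α)⟩
  refine ⟨⟨α, hmem⟩, ?_⟩
  exact hα.of_map (f := algebraMap (closure K M) M) (x := ⟨α, hmem⟩) Subtype.val_injective

end IsQuinticTower

end Tower

section RootSums

variable {K M : Type*} [Field K] [Field M] [Algebra K M]

theorem map_roots_algEquiv [IsAlgClosed M] (p : K[X]) (σ : M ≃ₐ[K] M) :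
    (p.map (algebraMap K M)).roots.map σ = (p.map (algebraMap K M)).roots := by
  have h := (IsAlgClosed.splits (p.map (algebraMap K M))).roots_map (σ : M →+* M)
  rw [Polynomial.map_map] at h
  have h2 : (σ : M →+* M).comp (algebraMap K M) = algebraMap K M := RingHom.ext fun x => by simp
  rw [h2] at h
  exact h.symm

/-- The sum of the values of a polynomial at the roots of `p` is rational over the field of
definition of the polynomial. -/
theorem exists_rootSum_functional [CharZero K] [IsAlgClosed M] [Algebra.IsAlgebraic K M]
    (E : IntermediateField K M) (p : K[X]) :
    ∃ τ : E[X] →ₗ[E] E, ∀ g, (τ g : M) =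
      ((p.map (algebraMap K M)).roots.map fun x => aeval x g).sum := by
  have : IsAlgClosure K M := ⟨inferInstance, inferInstance⟩
  have : Normal K M := IsAlgClosure.normal K M
  have : Normal E M := Normal.tower_top_of_normal K E M
  have : CharZero E := charZero_of_injective_algebraMap (algebraMap K E).injective
  have : Algebra.IsAlgebraic E M := Algebra.IsAlgebraic.tower_top (K := K) E
  have : IsGalois E M := ⟨⟩
  have hfix : ∀ g : E[X], ∃ y : E, (y : M) =
      ((p.map (algebraMap K M)).roots.map fun x => aeval x g).sum := fun g => by
    refine (InfiniteGalois.mem_range_algebraMap_iff_fixed _).2 fun σ => ?_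
    conv_rhs => rw [← map_roots_algEquiv p (σ.restrictScalars K)]
    rw [map_multiset_sum, Multiset.map_map, Multiset.map_map]
    refine congrArg Multiset.sum (Multiset.map_congr rfl fun x _ => ?_)
    exact (aeval_algHom_apply (σ : M →ₐ[E] M) x g).symm
  choose τ hτ using hfix
  refine ⟨{ toFun := τ, map_add' := fun f g => ?_, map_smul' := fun c g => ?_ }, hτ⟩
  · refine Subtype.ext ?_
    simp [hτ, Multiset.sum_map_add]
  · refine Subtype.ext ?_
    simp [hτ, Algebra.smul_def, Multiset.sum_map_mul_left]

/-- Over a tower of equations of degree at most five there is a nonzero polynomial of degree less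
than nine whose values at the roots of `p` have vanishing first four power sums. -/
theorem exists_tower_rootSum_pow_eq_zero [CharZero K] [IsAlgClosed M] [Algebra.IsAlgebraic K M]
    (p : K[X]) :
    ∃ L : IntermediateField K M, IsQuinticTower L ∧ ∃ g : L[X], g ≠ 0 ∧ g.degree < 9 ∧
      ∀ j, 0 < j → j ≤ 4 →
        ((p.map (algebraMap K M)).roots.map fun x => aeval x g ^ j).sum = 0 := by
  have : CharZero (IsQuinticTower.closure K M) :=
    charZero_of_injective_algebraMap (algebraMap K _).injective
  obtain ⟨τ, hτ⟩ := exists_rootSum_functional (IsQuinticTower.closure K M) p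
  obtain ⟨⟨g, hg⟩, hg0, h1, h2, h3, h4⟩ :=
    IsQuinticTower.quinticClosed_closure.exists_four_powers_zero
      (V := degreeLT (IsQuinticTower.closure K M) 9)
      (by rw [LinearEquiv.finrank_eq (degreeLTEquiv _ 9), finrank_fin_fun])
      τ (Submodule.subtype _)
  obtain ⟨L, hL, hc⟩ := IsQuinticTower.exists_coeff_mem
    (f := g.map (algebraMap (IsQuinticTower.closure K M) M)) fun i => by
      rw [coeff_map]; exact (g.coeff i).2
  obtain ⟨g', hg'⟩ : ∃ g' : L[X], g'.map (algebraMap L M) = g.map (algebraMap _ M) :=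
    (Polynomial.lifts_iff_coeff_lifts _).2 fun i => ⟨⟨_, hc i⟩, rfl⟩
  have hev : ∀ x : M, aeval x g' = aeval x g := fun x => by
    rw [← eval_map_algebraMap, hg', eval_map_algebraMap]
  refine ⟨L, hL, g', ?_, ?_, fun j hj hj4 => ?_⟩
  · rintro rfl
    refine hg0 (Subtype.ext ?_)
    rw [Polynomial.map_zero, eq_comm, Polynomial.map_eq_zero] at hg'
    exact hg'
  · rw [← degree_map g' (algebraMap L M), hg', degree_map]
    exact mem_degreeLT.1 hg
  · have : τ (g ^ j) = 0 := by
      interval_cases j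
      · simpa using h1
      · exact h2
      · exact h3
      · exact h4
    simp_rw [hev, ← map_pow]
    rw [← hτ, this]
    rfl

theorem Multiset.coeff_prod_X_sub_C_eq_zero {R : Type*} [Field R] [CharZero R] (s : Multiset R)
    {k : ℕ} (hk : k ≠ 0) (hks : k ≤ s.card)
    (h : ∀ j, 0 < j → j ≤ k → (s.map (· ^ j)).sum = 0) :
    (s.map fun x => X - C x).prod.coeff (s.card - k) = 0 := by
  rw [Multiset.prod_X_sub_C_coeff _ (Nat.sub_le _ _), Nat.sub_sub_self hks,
    s.esymm_eq_zero_of_power_sums hk h, mul_zero]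

theorem map_rootSum {N : Type*} [Field N] [Algebra K N] {p : K[X]}
    (hp : (p.map (algebraMap K N)).Splits) (ψ : N →ₐ[K] M) (g : K[X]) (j : ℕ) :
    ψ ((p.map (algebraMap K N)).roots.map fun x => aeval x g ^ j).sum =
      ((p.map (algebraMap K M)).roots.map fun x => aeval x g ^ j).sum := by
  have h := hp.roots_map (ψ : N →+* M)
  rw [Polynomial.map_map, AlgHom.comp_algebraMap] at h
  rw [h, map_multiset_sum, Multiset.map_map, Multiset.map_map]
  refine congrArg Multiset.sum (Multiset.map_congr rfl fun x _ => ?_)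
  change ψ (aeval x g ^ j) = aeval (ψ x) g ^ j
  rw [aeval_algHom_apply, map_pow]

theorem coeff_prod_X_sub_C_aeval_eq_zero {N : Type*} [Field N] [CharZero N] [Algebra K N] {p : K[X]}
    (hp : (p.map (algebraMap K N)).Splits) (ψ : N →ₐ[K] M) (g : K[X]) {k : ℕ} (hk : k ≠ 0)
    (hkp : k ≤ p.natDegree) (hsum : ∀ j, 0 < j → j ≤ k →
      ((p.map (algebraMap K M)).roots.map fun x => aeval x g ^ j).sum = 0) :
    ((p.map (algebraMap K N)).roots.map fun x => X - C (aeval x g)).prod.coeff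
      (p.natDegree - k) = 0 := by
  have hcard : (p.map (algebraMap K N)).roots.card = p.natDegree := by
    rw [← hp.natDegree_eq_card_roots, natDegree_map]
  have h := Multiset.coeff_prod_X_sub_C_eq_zero
    ((p.map (algebraMap K N)).roots.map fun x => aeval x g) hk
    (by rwa [Multiset.card_map, hcard]) fun j hj hjk => ψ.injective (by
      rw [Multiset.map_map, map_zero]
      exact (map_rootSum hp ψ g j).trans (hsum j hj hjk))
  rwa [Multiset.card_map, hcard, Multiset.map_map] at h

end RootSums

end

/-- **Wiman's theorem for degree 9.** The general equation of degree `9` over a field of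
characteristic zero can be brought, by a Tschirnhaus transformation whose parameters lie in
an extension obtainable by auxiliary equations of degree at most `5`, to the form
`Y^9 + C₅ Y^4 + C₆ Y^3 + C₇ Y^2 + C₈ Y + C₉`, i.e. with vanishing coefficients in degrees
`Y^8`, `Y^7`, `Y^6`, `Y^5`. -/
theorem wiman_degree_nine (F : Type) [Field F] [CharZero F] (n : ℕ) (hn : n = 9)
    (K : Type) [Field K] [Algebra (MvPolynomial (Fin n) F) K]
    [IsFractionRing (MvPolynomial (Fin n) F) K]
    (c : Fin n → K)
    (hc : ∀ i, c i = algebraMap (MvPolynomial (Fin n) F) K (MvPolynomial.X i))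
    (p : K[X])
    (hp : p = X ^ n + ∑ i : Fin n, Polynomial.C (c i) * X ^ (n - ((i : ℕ) + 1))) :
    ∃ (L : Type) (_ : Field L) (_ : Algebra K L),
      ObtainableByAuxDegLE K L 5 ∧
      ∃ a : Fin n → L, (∃ i : Fin n, (i : ℕ) ≠ 0 ∧ a i ≠ 0) ∧
        letI M := (p.map (algebraMap K L)).SplittingField
        letI q : M[X] :=
          (((p.map (algebraMap K L)).map (algebraMap L M)).roots.map
            (fun x => (Polynomial.X : M[X]) - Polynomial.C (∑ k : Fin n,
              algebraMap L M (a k) * x ^ (k : ℕ)))).prod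
        q.coeff (n - 1) = 0 ∧ q.coeff (n - 2) = 0 ∧ q.coeff (n - 3) = 0 ∧
          q.coeff (n - 4) = 0 := by
  subst hn
  have hCK : CharZero K := charZero_of_injective_ringHom
    (f := (algebraMap (MvPolynomial (Fin 9) F) K).comp MvPolynomial.C)
    ((IsFractionRing.injective _ _).comp (MvPolynomial.C_injective _ _))
  have hpdeg : p.natDegree = 9 := by
    rw [hp, natDegree_add_eq_left_of_degree_lt, natDegree_X_pow]
    rw [degree_X_pow]
    refine (degree_sum_le _ _).trans_lt ((Finset.sup_lt_iff (WithBot.bot_lt_coe 9)).2 fun i _ => ?_)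
    exact (degree_C_mul_X_pow_le _ _).trans_lt
      (by exact_mod_cast (by omega : 9 - ((i : ℕ) + 1) < 9))
  set M := AlgebraicClosure K
  have hcard : (p.map (algebraMap K M)).roots.card = 9 := by
    rw [← (IsAlgClosed.splits _).natDegree_eq_card_roots, natDegree_map, hpdeg]
  obtain ⟨L, hL, g, hg0, hgdeg, hsum⟩ := exists_tower_rootSum_pow_eq_zero (M := M) p
  refine ⟨L, inferInstance, inferInstance, hL.obtainable, fun i => g.coeff i, ?_, ?_⟩
  · by_contra! hz
    have hgC : g = C (g.coeff 0) := by
      refine eq_C_of_degree_le_zero (degree_le_iff_coeff_zero _ _ |>.2 fun i hi => ?_)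
      rcases lt_or_ge i 9 with h9 | h9
      · exact hz ⟨i, h9⟩ (by rintro rfl; simp at hi)
      · exact coeff_eq_zero_of_degree_lt (hgdeg.trans_le (by exact_mod_cast h9))
    have h1 := hsum 1 one_pos (by norm_num)
    rw [hgC] at h1
    simp only [aeval_C, pow_one, Multiset.map_const', Multiset.sum_replicate, hcard, smul_eq_zero,
      OfNat.ofNat_ne_zero, false_or, map_eq_zero] at h1
    exact hg0 (by rw [hgC, h1, C_0])
  · have hev (x : (p.map (algebraMap K L)).SplittingField) :
        ∑ k : Fin 9, algebraMap L (p.map (algebraMap K L)).SplittingField (g.coeff k) *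
          x ^ (k : ℕ) = aeval x g := by
      rw [aeval_eq_sum_range' ((natDegree_lt_iff_degree_lt hg0).2 hgdeg), Finset.sum_range]
      simp only [Algebra.smul_def]
    have hdeg : (p.map (algebraMap K L)).natDegree = 9 := by rw [natDegree_map, hpdeg]
    have : CharZero L := charZero_of_injective_algebraMap (algebraMap K L).injective
    have : CharZero (p.map (algebraMap K L)).SplittingField :=
      charZero_of_injective_algebraMap (algebraMap L _).injective
    have hcoeff (k : ℕ) (hk : k ≠ 0) (hk4 : k ≤ 4) :=
      coeff_prod_X_sub_C_aeval_eq_zero (SplittingField.splits (p.map (algebraMap K L)))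
        (IsAlgClosed.lift : _ →ₐ[L] M) g hk (by omega) fun j hj hjk => by
          rw [Polynomial.map_map, ← IsScalarTower.algebraMap_eq]
          exact hsum j hj (hjk.trans hk4)
    rw [hdeg] at hcoeff
    simp only [hev]
    exact ⟨hcoeff 1 (by norm_num) (by norm_num), hcoeff 2 (by norm_num) (by norm_num),
      hcoeff 3 (by norm_num) (by norm_num), hcoeff 4 (by norm_num) (by norm_num)⟩
end

section
/- (Bring–Jerrard) Let F be a field of characteristic zero and let n ≥ 5. Let K = F(c_1,…,c_n) and let p(X) = X^n + c_1 X^{n−1} + ⋯ + c_n ∈ K[X] be the general equation of degree n. Then there exist a field extension L of K obtainable by auxiliary equations of degree ≤ 3 and elements a_0, a_1, …, a_{n−1} ∈ L with (a_1,…,a_{n−1}) ≠ 0 such that, in a splitting field of p over L with roots x_1,…,x_n, the Tschirnhaus transform ∏_{i=1}^n (Y − (a_0 + a_1 x_i + ⋯ + a_{n−1} x_i^{n−1})) has vanishing coefficients in degrees Y^{n−1}, Y^{n−2} and Y^{n−3}; i.e., it has the form Y^n + C_4 Y^{n−4} + ⋯ + C_n. -/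
open Polynomial

theorem IntermediateField.rank_extendScalars_map {K L M : Type} [Field K] [Field L] [Field M]
    [Algebra K L] [Algebra K M] (φ : L →ₐ[K] M) {A B : IntermediateField K L} (h : A ≤ B) :
    Module.rank (A.map φ) (extendScalars (map_mono φ h)) = Module.rank A (extendScalars h) := by
  let j : extendScalars h →+* extendScalars (map_mono φ h) :=
    (φ.toRingHom.comp (extendScalars h).val.toRingHom).codRestrict
      (extendScalars (map_mono φ h)) fun x => ⟨x.1, x.2, rfl⟩
  have hj : Function.Bijective j := by
    refine ⟨j.injective, ?_⟩
    rintro ⟨_, x, hx, rfl⟩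
    exact ⟨⟨x, hx⟩, rfl⟩
  refine (Algebra.rank_eq_of_equiv_equiv (equivMap A φ).toRingEquiv
    (RingEquiv.ofBijective j hj) (RingHom.ext fun x => Subtype.ext ?_)).symm
  exact coe_equivMap_apply A φ x

theorem IntermediateField.rank_extendScalars_top_of_eq_fieldRange {K L M : Type}
    [Field K] [Field L] [Field M]
    [Algebra K L] [Algebra L M] [Algebra K M] [IsScalarTower K L M]
    {A : IntermediateField K M} (hA : A = (IsScalarTower.toAlgHom K L M).fieldRange) :
    Module.rank A (extendScalars (le_top (a := A))) = Module.rank L M := by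
  have hmem (x : L) : algebraMap L M x ∈ A := hA ▸ ⟨x, rfl⟩
  let i : L →+* A := (algebraMap L M).codRestrict A hmem
  have hi : Function.Bijective i := by
    refine ⟨i.injective, ?_⟩
    rintro ⟨y, hy⟩
    obtain ⟨x, hx⟩ : y ∈ (IsScalarTower.toAlgHom K L M).fieldRange := hA ▸ hy
    exact ⟨x, Subtype.ext hx⟩
  let j : M →+* extendScalars (le_top (a := A)) := (RingHom.id M).codRestrict _ fun _ =>
    (mem_extendScalars _).mpr mem_top
  have hj : Function.Bijective j := ⟨j.injective, fun y => ⟨y.1, Subtype.ext rfl⟩⟩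
  exact (Algebra.rank_eq_of_equiv_equiv (RingEquiv.ofBijective i hi)
    (RingEquiv.ofBijective j hj) (RingHom.ext fun x => Subtype.ext rfl)).symm


/-- Extending the top of a tower by an extension of degree at most `m` again gives a field
obtainable by auxiliary equations of degree at most `m`. -/
theorem ObtainableByAuxDegLE.trans_rank_le {K L M : Type} [Field K] [Field L] [Field M]
    [Algebra K L] [Algebra L M] [Algebra K M] [IsScalarTower K L M] {m : ℕ}
    (h : ObtainableByAuxDegLE K L m) (hM : Module.rank L M ≤ m) :
    ObtainableByAuxDegLE K M m := by
  obtain ⟨r, T, h0, h1, hT⟩ := h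
  let φ : L →ₐ[K] M := IsScalarTower.toAlgHom K L M
  let T' : Fin (r + 1 + 1) → IntermediateField K M :=
    Fin.snoc (α := fun _ => IntermediateField K M) (fun i => (T i).map φ) ⊤
  have hcast : ∀ i : Fin (r + 1), T' i.castSucc = (T i).map φ := fun i => by simp [T']
  have hlast : T' (Fin.last (r + 1)) = ⊤ := by simp [T']
  have key : ∀ (A B A' B' : IntermediateField K M) (hA : A' = A) (hB : B' = B),
      (∃ h : A ≤ B, Module.rank A (IntermediateField.extendScalars h) ≤ m) →
      ∃ h : A' ≤ B', Module.rank A' (IntermediateField.extendScalars h) ≤ m := by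
    rintro A B _ _ rfl rfl h
    exact h
  refine ⟨r + 1, T', ?_, hlast, fun i => ?_⟩
  · rw [← Fin.castSucc_zero, hcast, h0, IntermediateField.map_bot]
  · induction i using Fin.lastCases with
    | last =>
      refine key _ _ _ _ (hcast _) (by rw [Fin.succ_last, hlast]) ⟨le_top, ?_⟩
      refine (IntermediateField.rank_extendScalars_top_of_eq_fieldRange ?_).trans_le hM
      rw [h1, ← AlgHom.fieldRange_eq_map]
    | cast i =>
      obtain ⟨hi, hr⟩ := hT i
      refine key _ _ _ _ (hcast _) (by rw [← Fin.castSucc_succ, hcast])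
        ⟨IntermediateField.map_mono φ hi, ?_⟩
      exact (IntermediateField.rank_extendScalars_map φ hi).trans_le hr

theorem ObtainableByAuxDegLE.refl (K : Type) [Field K] (m : ℕ) : ObtainableByAuxDegLE K K m :=
  ⟨0, fun _ => ⊥, rfl, Subsingleton.elim _ _, fun i => i.elim0⟩

/-- A polynomial of degree between `1` and `m` has a root in an extension of degree at most `m`. -/
theorem exists_extension_rank_le_root {L : Type} [Field L] {m : ℕ} (f : L[X])
    (h0 : f.natDegree ≠ 0) (hm : f.natDegree ≤ m) :
    ∃ (M : Type) (_ : Field M) (_ : Algebra L M), Module.rank L M ≤ m ∧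
      ∃ x : M, aeval x f = 0 := by
  obtain ⟨g, hg, hgf⟩ := exists_irreducible_of_natDegree_ne_zero h0
  have : Fact (Irreducible g) := ⟨hg⟩
  have hf : f ≠ 0 := by rintro rfl; simp at h0
  refine ⟨AdjoinRoot g, inferInstance, inferInstance, ?_, AdjoinRoot.root g, ?_⟩
  · have := (AdjoinRoot.powerBasis hg.ne_zero).finite
    rw [← Module.finrank_eq_rank, (AdjoinRoot.powerBasis hg.ne_zero).finrank,
      AdjoinRoot.powerBasis_dim]
    exact_mod_cast (natDegree_le_of_dvd hgf hf).trans hm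
  · rw [AdjoinRoot.aeval_eq, AdjoinRoot.mk_eq_zero]
    exact hgf

/-- A binary form of positive degree `d ≤ m` acquires a nontrivial zero in an extension of degree
at most `m`. -/
theorem exists_extension_binary_form_zero {K L : Type} [Field K] [Field L] [Algebra K L] {m : ℕ}
    (h : ObtainableByAuxDegLE K L m) {d : ℕ} (hd : d ≠ 0) (hdm : d ≤ m) (c : ℕ → L) :
    ∃ (M : Type) (_ : Field M) (_ : Algebra L M) (_ : Algebra K M) (_ : IsScalarTower K L M),
      ObtainableByAuxDegLE K M m ∧ ∃ s t : M, (s ≠ 0 ∨ t ≠ 0) ∧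
        ∑ i ∈ Finset.range (d + 1), algebraMap L M (c i) * s ^ i * t ^ (d - i) = 0 := by
  by_cases hc : c d = 0
  · refine ⟨L, inferInstance, inferInstance, inferInstance, inferInstance, h, 1, 0, by simp, ?_⟩
    refine Finset.sum_eq_zero fun i hi => ?_
    rcases (Nat.lt_succ_iff.mp (Finset.mem_range.mp hi)).eq_or_lt with rfl | hlt
    · simp [hc]
    · simp [Nat.sub_ne_zero_of_lt hlt]
  · let f : L[X] := ∑ i ∈ Finset.range (d + 1), C (c i) * X ^ i
    have hcoeff : f.coeff d = c d := by simp [f, coeff_X_pow]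
    have hle : f.natDegree ≤ d := by
      refine natDegree_sum_le_of_forall_le _ _ fun i hi => ?_
      exact (natDegree_C_mul_X_pow_le _ _).trans (Nat.lt_succ_iff.mp (Finset.mem_range.mp hi))
    have hge : d ≤ f.natDegree := le_natDegree_of_ne_zero (hcoeff ▸ hc)
    obtain ⟨M, _, _, hM, x, hx⟩ :=
      exists_extension_rank_le_root (m := m) f (by omega) (by omega)
    let _ : Algebra K M := ((algebraMap L M).comp (algebraMap K L)).toAlgebra
    have : IsScalarTower K L M := IsScalarTower.of_algebraMap_eq fun _ => rfl
    refine ⟨M, inferInstance, inferInstance, inferInstance, inferInstance,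
      h.trans_rank_le hM, x, 1, by simp, ?_⟩
    simpa [f] using hx

/-- The extension of scalars of a linear functional on polynomials. -/
noncomputable def polynomialFunctionalExtend {K : Type} (L : Type) [Field K] [Field L]
    [Algebra K L] (φ : K[X] →ₗ[K] K) : L[X] →ₗ[L] L :=
  Polynomial.lsum fun k => (algebraMap K L (φ (X ^ k))) • LinearMap.id

theorem polynomialFunctionalExtend_C_mul_X_pow {K L : Type} [Field K] [Field L] [Algebra K L]
    (φ : K[X] →ₗ[K] K) (a : L) (k : ℕ) :
    polynomialFunctionalExtend L φ (C a * X ^ k) = a * algebraMap K L (φ (X ^ k)) := by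
  rw [C_mul_X_pow_eq_monomial, polynomialFunctionalExtend, lsum_apply,
    sum_monomial_index _ _ (by simp)]
  simp [mul_comm, Algebra.smul_def]

theorem polynomialFunctionalExtend_C_mul {K L : Type} [Field K] [Field L] [Algebra K L]
    (φ : K[X] →ₗ[K] K) (a : L) (f : L[X]) :
    polynomialFunctionalExtend L φ (C a * f) = a * polynomialFunctionalExtend L φ f := by
  rw [← smul_eq_C_mul, map_smul, smul_eq_mul]

theorem polynomialFunctionalExtend_map {K L : Type} [Field K] [Field L] [Algebra K L]
    (φ : K[X] →ₗ[K] K) (f : K[X]) :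
    polynomialFunctionalExtend L φ (f.map (algebraMap K L)) = algebraMap K L (φ f) := by
  induction f using Polynomial.induction_on' with
  | add f g hf hg => simp only [Polynomial.map_add, map_add, hf, hg]
  | monomial k a =>
    rw [← C_mul_X_pow_eq_monomial, Polynomial.map_mul, map_C, Polynomial.map_pow, map_X,
      polynomialFunctionalExtend_C_mul_X_pow, ← smul_eq_C_mul, map_smul, smul_eq_mul, map_mul]

theorem polynomialFunctionalExtend_map_tower {K L M : Type} [Field K] [Field L] [Field M]
    [Algebra K L] [Algebra L M] [Algebra K M] [IsScalarTower K L M]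
    (φ : K[X] →ₗ[K] K) (f : L[X]) :
    polynomialFunctionalExtend M φ (f.map (algebraMap L M)) =
      algebraMap L M (polynomialFunctionalExtend L φ f) := by
  induction f using Polynomial.induction_on' with
  | add f g hf hg => simp only [Polynomial.map_add, map_add, hf, hg]
  | monomial k a =>
    rw [← C_mul_X_pow_eq_monomial, Polynomial.map_mul, map_C, Polynomial.map_pow, map_X,
      polynomialFunctionalExtend_C_mul_X_pow, polynomialFunctionalExtend_C_mul_X_pow, map_mul,
      ← IsScalarTower.algebraMap_apply]

/-- For a linear functional on polynomials over a field, there are four linearly independent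
polynomials of degree less than `n` in its kernel, pairwise orthogonal for the associated
bilinear form. -/
theorem exists_four_orthogonal {K : Type} [Field K] [CharZero K] (Λ : K[X] →ₗ[K] K) {n : ℕ}
    (hn : 5 ≤ n) :
    ∃ v : Fin 4 → K[X], LinearIndependent K v ∧ (∀ i, (v i).degree < n) ∧ (∀ i, Λ (v i) = 0) ∧
      ∀ i j, i ≠ j → Λ (v i * v j) = 0 := by
  let D := degreeLT K n
  have hD : Module.finrank K D = n := by
    rw [(degreeLTEquiv K n).finrank_eq]; simp
  have : FiniteDimensional K D := (degreeLTEquiv K n).symm.finiteDimensional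
  let W := LinearMap.ker (Λ.domRestrict D)
  have hW : 4 ≤ Module.finrank K W := by
    have h1 := LinearMap.finrank_range_add_finrank_ker (Λ.domRestrict D)
    have h2 : Module.finrank K (LinearMap.range (Λ.domRestrict D)) ≤ 1 := by
      simpa using Submodule.finrank_le (LinearMap.range (Λ.domRestrict D))
    have h3 : Module.finrank K W = Module.finrank K (LinearMap.ker (Λ.domRestrict D)) := rfl
    omega
  let ι : W →ₗ[K] K[X] := D.subtype ∘ₗ W.subtype
  have hι : Function.Injective ι :=
    D.injective_subtype.comp W.injective_subtype
  let B : LinearMap.BilinForm K W := ((LinearMap.mul K K[X]).compr₂ Λ).compl₁₂ ι ι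
  have hB : ∀ x y, B x y = Λ (ι x * ι y) := fun _ _ => rfl
  have hsymm : LinearMap.IsSymm B := ⟨fun x y => by simp [hB, mul_comm]⟩
  have : Invertible (2 : K) := invertibleOfNonzero two_ne_zero
  obtain ⟨b, hb⟩ := LinearMap.BilinForm.exists_orthogonal_basis (V := W) (K := K) (B := B) hsymm
  refine ⟨fun i => ι (b (Fin.castLE hW i)), ?_, fun i => ?_, fun i => ?_, fun i j hij => ?_⟩
  · exact (b.linearIndependent.map_injOn ι hι.injOn).comp _
      (Fin.castLE_injective hW)
  · exact mem_degreeLT.mp (b (Fin.castLE hW i)).1.2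
  · exact (b (Fin.castLE hW i)).2
  · exact hb fun h => hij (Fin.castLE_injective hW h)

theorem exists_dual_family {K V : Type} [Field K] [AddCommGroup V] [Module K V] {ι : Type}
    [Fintype ι] [DecidableEq ι] {v : ι → V} (hv : LinearIndependent K v) :
    ∃ φ : ι → V →ₗ[K] K, ∀ i j, φ i (v j) = if i = j then 1 else 0 := by
  obtain ⟨g, hg⟩ := LinearMap.exists_leftInverse_of_injective (Fintype.linearCombination K v)
    (LinearMap.ker_eq_bot.mpr hv.fintypeLinearCombination_injective)
  refine ⟨fun i => LinearMap.proj i ∘ₗ g, fun i j => ?_⟩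
  have := congrFun (LinearMap.congr_fun hg (Pi.single j 1)) i
  simpa [Fintype.linearCombination_apply_single, Pi.single_apply] using this

/-- After an extension obtainable by auxiliary equations of degree at most `3`, a linear functional
on polynomials vanishes on `f`, `f ^ 2` and `f ^ 3` for a nonzero `f` of degree less than `n`. -/
theorem exists_extension_functional_pow_eq_zero {K : Type} [Field K] [CharZero K]
    (Λ : K[X] →ₗ[K] K) {n : ℕ} (hn : 5 ≤ n) :
    ∃ (L : Type) (_ : Field L) (_ : Algebra K L), ObtainableByAuxDegLE K L 3 ∧
      ∃ f : L[X], f ≠ 0 ∧ f.degree < n ∧ ∀ j ∈ Finset.Icc 1 3,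
        polynomialFunctionalExtend L Λ (f ^ j) = 0 := by
  obtain ⟨v, hv, hdeg, hΛ, horth⟩ := exists_four_orthogonal Λ hn
  obtain ⟨φ, hφ⟩ := exists_dual_family hv
  obtain ⟨L₁, _, A₁, A₂, hA, hL₁, s, t, hst, h₁⟩ := exists_extension_binary_form_zero
    (ObtainableByAuxDegLE.refl K 3) (d := 2) (by norm_num) (by norm_num)
    (fun i => if i = 0 then Λ (v 1 * v 1) else if i = 2 then Λ (v 0 * v 0) else 0)
  obtain rfl : A₁ = A₂ := Algebra.algebra_ext _ _ fun a =>
    (@IsScalarTower.algebraMap_apply K K L₁ _ _ _ _ A₁ A₂ hA a).symm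
  obtain ⟨L₂, _, _, _, _, hL₂, s', t', hst', h₂⟩ := exists_extension_binary_form_zero
    hL₁ (d := 2) (by norm_num) (by norm_num)
    (fun i => algebraMap K L₁
      (if i = 0 then Λ (v 3 * v 3) else if i = 2 then Λ (v 2 * v 2) else 0))
  let Λ₂ := polynomialFunctionalExtend L₂ Λ
  let w (L : Type) [Field L] [Algebra K L] (i : Fin 4) : L[X] := (v i).map (algebraMap K L)
  let g : L₂[X] := C (algebraMap L₁ L₂ s) * w L₂ 0 + C (algebraMap L₁ L₂ t) * w L₂ 1
  let g' : L₂[X] := C s' * w L₂ 2 + C t' * w L₂ 3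
  obtain ⟨L, _, _, _, _, hL, x, y, hxy, h₃⟩ := exists_extension_binary_form_zero
    hL₂ (d := 3) (by norm_num) (by norm_num)
    (fun i => if i = 0 then Λ₂ (g' ^ 3) else if i = 1 then 3 * Λ₂ (g * g' ^ 2) else
      if i = 2 then 3 * Λ₂ (g ^ 2 * g') else Λ₂ (g ^ 3))
  have hΛ₂ : ∀ a f, Λ₂ (C a * f) = a * Λ₂ f := polynomialFunctionalExtend_C_mul Λ
  have hw : ∀ f, Λ₂ (map (algebraMap K L₂) f) = algebraMap K L₂ (Λ f) :=
    polynomialFunctionalExtend_map Λ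
  have h₁' : Λ₂ (g ^ 2) = 0 := by
    have : g ^ 2 = C (algebraMap L₁ L₂ (s ^ 2)) * map (algebraMap K L₂) (v 0 * v 0) +
        C (algebraMap L₁ L₂ (2 * s * t)) * map (algebraMap K L₂) (v 0 * v 1) +
        C (algebraMap L₁ L₂ (t ^ 2)) * map (algebraMap K L₂) (v 1 * v 1) := by
      simp only [g, w, map_mul, map_pow, Polynomial.map_mul, map_ofNat]
      ring
    rw [this, map_add, map_add, hΛ₂, hΛ₂, hΛ₂, hw, hw, hw, horth 0 1 (by decide)]
    have := congrArg (algebraMap L₁ L₂) h₁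
    simp [Finset.sum_range_succ, ← IsScalarTower.algebraMap_apply] at this
    simp
    linear_combination this
  have h₂' : Λ₂ (g' ^ 2) = 0 := by
    have : g' ^ 2 = C (s' ^ 2) * map (algebraMap K L₂) (v 2 * v 2) +
        C (2 * s' * t') * map (algebraMap K L₂) (v 2 * v 3) +
        C (t' ^ 2) * map (algebraMap K L₂) (v 3 * v 3) := by
      simp only [g', w, map_mul, map_pow, Polynomial.map_mul, map_ofNat]
      ring
    rw [this, map_add, map_add, hΛ₂, hΛ₂, hΛ₂, hw, hw, hw, horth 2 3 (by decide)]
    simp [Finset.sum_range_succ, ← IsScalarTower.algebraMap_apply] at h₂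
    simp
    linear_combination h₂
  have h₁₂ : Λ₂ (g * g') = 0 := by
    have : g * g' = C (algebraMap L₁ L₂ s * s') * map (algebraMap K L₂) (v 0 * v 2) +
        C (algebraMap L₁ L₂ s * t') * map (algebraMap K L₂) (v 0 * v 3) +
        C (algebraMap L₁ L₂ t * s') * map (algebraMap K L₂) (v 1 * v 2) +
        C (algebraMap L₁ L₂ t * t') * map (algebraMap K L₂) (v 1 * v 3) := by
      simp only [g, g', w, map_mul, Polynomial.map_mul]
      ring
    rw [this]
    simp only [map_add, hΛ₂, hw]
    simp [horth]
  have h₀ : Λ₂ g = 0 := by simp [g, w, hΛ₂, hw, hΛ]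
  have h₀' : Λ₂ g' = 0 := by simp [g', w, hΛ₂, hw, hΛ]
  let f : L[X] := C x * map (algebraMap L₂ L) g + C y * map (algebraMap L₂ L) g'
  have hmap : ∀ (ψ : K[X] →ₗ[K] K) (a : L) (h : L₂[X]),
      polynomialFunctionalExtend L ψ (C a * map (algebraMap L₂ L) h) =
        a * algebraMap L₂ L (polynomialFunctionalExtend L₂ ψ h) := fun ψ a h => by
    rw [polynomialFunctionalExtend_C_mul, polynomialFunctionalExtend_map_tower]
  refine ⟨L, inferInstance, inferInstance, hL, f, fun hf => ?_, ?_, fun j hj => ?_⟩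
  · have hcoord : ∀ i, polynomialFunctionalExtend L (φ i) f = 0 := fun i => by rw [hf, map_zero]
    have hi : ∀ i j, polynomialFunctionalExtend L₂ (φ i) (w L₂ j) = if i = j then 1 else 0 :=
      fun i j => by
        rw [polynomialFunctionalExtend_map, hφ]
        split_ifs <;> simp
    have c0 := hcoord 0
    have c1 := hcoord 1
    have c2 := hcoord 2
    have c3 := hcoord 3
    simp [f, hmap, g, g', polynomialFunctionalExtend_C_mul, hi] at c0 c1 c2 c3
    grind
  · have hwdeg : ∀ (a : L₂) i, C a * w L₂ i ∈ degreeLT L₂ n := fun a i => by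
      rw [← smul_eq_C_mul]
      exact Submodule.smul_mem _ _ (mem_degreeLT.mpr (by simpa [w] using hdeg i))
    have hgdeg : ∀ (a : L) (h : L₂[X]), h ∈ degreeLT L₂ n →
        C a * map (algebraMap L₂ L) h ∈ degreeLT L n := fun a h hh => by
      rw [← smul_eq_C_mul]
      exact Submodule.smul_mem _ _ (mem_degreeLT.mpr (by simpa using mem_degreeLT.mp hh))
    exact mem_degreeLT.mp <| add_mem (hgdeg _ _ (add_mem (hwdeg _ _) (hwdeg _ _)))
      (hgdeg _ _ (add_mem (hwdeg _ _) (hwdeg _ _)))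
  · obtain ⟨hj1, hj3⟩ := Finset.mem_Icc.mp hj
    interval_cases j
    · rw [pow_one, map_add, hmap, hmap]
      simp [Λ₂] at h₀ h₀'
      simp [h₀, h₀']
    · have : f ^ 2 = C (x ^ 2) * map (algebraMap L₂ L) (g ^ 2) +
          C (2 * x * y) * map (algebraMap L₂ L) (g * g') +
          C (y ^ 2) * map (algebraMap L₂ L) (g' ^ 2) := by
        simp only [f, map_mul, map_pow, Polynomial.map_mul, Polynomial.map_pow, map_ofNat]
        ring
      rw [this, map_add, map_add, hmap, hmap, hmap]
      change _ * algebraMap L₂ L (Λ₂ _) + _ * algebraMap L₂ L (Λ₂ _) +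
        _ * algebraMap L₂ L (Λ₂ _) = 0
      simp [h₁', h₁₂, h₂']
    · have : f ^ 3 = C (x ^ 3) * map (algebraMap L₂ L) (g ^ 3) +
          C (3 * x ^ 2 * y) * map (algebraMap L₂ L) (g ^ 2 * g') +
          C (3 * x * y ^ 2) * map (algebraMap L₂ L) (g * g' ^ 2) +
          C (y ^ 3) * map (algebraMap L₂ L) (g' ^ 3) := by
        simp only [f, map_mul, map_pow, Polynomial.map_mul, Polynomial.map_pow, map_ofNat]
        ring
      rw [this, map_add, map_add, map_add, hmap, hmap, hmap, hmap]
      simp [Finset.sum_range_succ, -map_mul] at h₃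
      simp only [map_mul, map_ofNat] at h₃
      linear_combination h₃

/-- If the first `m` power sums of a multiset vanish, so do its first `m` elementary symmetric
functions. -/
theorem Multiset.esymm_eq_zero_of_sum_pow_eq_zero {M : Type} [Field M] [CharZero M]
    (s : Multiset M) {m : ℕ} (h : ∀ j ∈ Finset.Icc 1 m, (s.map (· ^ j)).sum = 0) {k : ℕ}
    (hk : k ∈ Finset.Icc 1 m) : s.esymm k = 0 := by
  obtain ⟨hk1, hkm⟩ := Finset.mem_Icc.mp hk
  let f : Fin s.toList.length → M := s.toList.get
  have hs : Finset.univ.val.map f = s := by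
    rw [Fin.univ_val_map, List.ofFn_get, Multiset.coe_toList]
  have key := congrArg (MvPolynomial.aeval f)
    (MvPolynomial.mul_esymm_eq_sum (Fin s.toList.length) M k)
  rw [map_mul, MvPolynomial.aeval_esymm_eq_multiset_esymm, hs, map_mul, map_sum,
    Finset.sum_eq_zero, mul_zero, map_natCast] at key
  · exact (mul_eq_zero.mp key).resolve_left (Nat.cast_ne_zero.mpr (by omega))
  · intro a ha
    obtain ⟨ha, hlt⟩ := Finset.mem_filter.mp ha
    have hsum := Finset.HasAntidiagonal.mem_antidiagonal.mp ha
    have hp := h a.2 (Finset.mem_Icc.mpr (by omega))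
    rw [← hs, Multiset.map_map] at hp
    rw [map_mul, MvPolynomial.psum, map_sum]
    simp only [map_pow, MvPolynomial.aeval_X]
    exact mul_eq_zero_of_right _ hp

theorem coeff_prod_X_sub_C_eq_zero_of_sum_pow_eq_zero {M : Type} [Field M] [CharZero M]
    (s : Multiset M) {m : ℕ} (h : ∀ j ∈ Finset.Icc 1 m, (s.map (· ^ j)).sum = 0)
    (hm : m ≤ s.card) {k : ℕ} (hk : k ∈ Finset.Icc 1 m) :
    (s.map fun t => X - C t).prod.coeff (s.card - k) = 0 := by
  have := Finset.mem_Icc.mp hk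
  rw [Multiset.prod_X_sub_C_coeff s (Nat.sub_le _ _), Nat.sub_sub_self (by omega),
    s.esymm_eq_zero_of_sum_pow_eq_zero h hk, mul_zero]

/-- The power sums of the roots of a polynomial, as a linear functional over the base field. -/
theorem exists_functional_eq_sum_roots {K : Type} [Field K] [CharZero K] (p : K[X]) :
    ∃ Λ : K[X] →ₗ[K] K, ∀ (M : Type) [Field M] [Algebra K M],
      (p.map (algebraMap K M)).Splits → ∀ k : ℕ,
        algebraMap K M (Λ (X ^ k)) = ((p.map (algebraMap K M)).roots.map (· ^ k)).sum := by
  let N := p.SplittingField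
  have hN : (p.map (algebraMap K N)).Splits := SplittingField.splits p
  have : Normal K N := Normal.of_isSplittingField p
  have : IsGalois K N := ⟨⟩
  have hP : ∀ k : ℕ, ∃ a : K,
      algebraMap K N a = ((p.map (algebraMap K N)).roots.map (· ^ k)).sum := fun k => by
    refine IntermediateField.mem_bot.mp ((IsGalois.mem_bot_iff_fixed _).mpr fun σ => ?_)
    have hσ : (p.map (algebraMap K N)).roots.map σ = (p.map (algebraMap K N)).roots := by
      have := hN.roots_map (σ : N →+* N)
      rw [Polynomial.map_map] at this
      rw [show ((σ : N →+* N).comp (algebraMap K N)) = algebraMap K N from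
        σ.toAlgHom.comp_algebraMap] at this
      exact this.symm
    conv_rhs => rw [← hσ]
    rw [map_multiset_sum, Multiset.map_map, Multiset.map_map]
    simp
  choose P hP using hP
  refine ⟨Polynomial.lsum fun k => P k • LinearMap.id, fun M _ _ hM k => ?_⟩
  let ψ : N →ₐ[K] M := IsSplittingField.lift N p hM
  have hψ : (p.map (algebraMap K M)).roots = (p.map (algebraMap K N)).roots.map ψ := by
    have := hN.roots_map (ψ : N →+* M)
    rwa [Polynomial.map_map, show ((ψ : N →+* M).comp (algebraMap K N)) = algebraMap K M from
      ψ.comp_algebraMap] at this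
  have hX : (Polynomial.lsum fun k => P k • LinearMap.id : K[X] →ₗ[K] K) (X ^ k) = P k := by
    rw [X_pow_eq_monomial, lsum_apply, sum_monomial_index _ _ (by simp)]
    simp
  rw [hX, hψ, Multiset.map_map, ← ψ.commutes, hP, map_multiset_sum, Multiset.map_map]
  simp

theorem algebraMap_polynomialFunctionalExtend {K L M : Type} [Field K] [Field L] [Field M]
    [Algebra K L] [Algebra L M] [Algebra K M] [IsScalarTower K L M] (φ : K[X] →ₗ[K] K)
    (s : Multiset M) (hs : ∀ k : ℕ, algebraMap K M (φ (X ^ k)) = (s.map (· ^ k)).sum) (f : L[X]) :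
    algebraMap L M (polynomialFunctionalExtend L φ f) = (s.map fun x => aeval x f).sum := by
  induction f using Polynomial.induction_on' with
  | add f g hf hg => simp only [map_add, hf, hg, Multiset.sum_map_add]
  | monomial k a =>
    simp only [aeval_monomial, Multiset.sum_map_mul_left]
    rw [← C_mul_X_pow_eq_monomial, polynomialFunctionalExtend_C_mul_X_pow, map_mul,
      ← IsScalarTower.algebraMap_apply, hs]

/-- If the trace functional `φ` of `p` vanishes on the first `m` powers of `f`, then the Tschirnhaus
transform of `p` by the coefficients of `f` has vanishing coefficients below the leading one, down
to degree `n - m`. -/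
theorem coeff_tschirnhaus_eq_zero {K L M : Type} [Field K] [Field L] [Field M] [CharZero M]
    [Algebra K L] [Algebra L M] [Algebra K M] [IsScalarTower K L M] {p : K[X]} {n m : ℕ}
    (hn : p.natDegree = n) (hm : m ≤ n) (hM : (p.map (algebraMap K M)).Splits)
    {φ : K[X] →ₗ[K] K} (hφ : ∀ k : ℕ, algebraMap K M (φ (X ^ k)) =
      ((p.map (algebraMap K M)).roots.map (· ^ k)).sum)
    {f : L[X]} (hfdeg : f.degree < n)
    (hf : ∀ j ∈ Finset.Icc 1 m, polynomialFunctionalExtend L φ (f ^ j) = 0)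
    {k : ℕ} (hk : k ∈ Finset.Icc 1 m) :
    (((p.map (algebraMap K L)).map (algebraMap L M)).roots.map
      (fun x => (X : M[X]) - C (∑ i : Fin n, algebraMap L M (f.coeff i) * x ^ (i : ℕ)))).prod.coeff
        (n - k) = 0 := by
  have hsum : ∀ x : M, ∑ i : Fin n, algebraMap L M (f.coeff i) * x ^ (i : ℕ) = aeval x f :=
    fun x => by
      rcases eq_or_ne f 0 with rfl | hf0
      · simp
      · rw [aeval_def, eval₂_eq_sum_range' _ ((natDegree_lt_iff_degree_lt hf0).mpr hfdeg),
          Finset.sum_range]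
  simp only [hsum]
  rw [Polynomial.map_map, ← IsScalarTower.algebraMap_eq]
  have hcard : ((p.map (algebraMap K M)).roots.map fun x => aeval x f).card = n := by
    rw [Multiset.card_map, ← hM.natDegree_eq_card_roots, natDegree_map, hn]
  have := coeff_prod_X_sub_C_eq_zero_of_sum_pow_eq_zero
    ((p.map (algebraMap K M)).roots.map fun x => aeval x f) (fun j hj => ?_) (hm.trans hcard.ge) hk
  · rwa [hcard, Multiset.map_map] at this
  · have := algebraMap_polynomialFunctionalExtend φ _ hφ (f ^ j)
    rw [hf j hj, map_zero] at this
    rw [Multiset.map_map, this]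
    simp

/-- **Bring–Jerrard.** For `n ≥ 5`, the general equation of degree `n` over a field of
characteristic zero can be brought, by a Tschirnhaus transformation whose parameters lie in
an extension obtainable by auxiliary equations of degree at most `3`, to the form
`Y^n + C₄ Y^(n-4) + ⋯ + C_n`, i.e. with vanishing coefficients in degrees
`Y^(n-1)`, `Y^(n-2)`, `Y^(n-3)`. -/
theorem bring_jerrard (F : Type) [Field F] [CharZero F] (n : ℕ) (hn : 5 ≤ n)
    (K : Type) [Field K] [Algebra (MvPolynomial (Fin n) F) K]
    [IsFractionRing (MvPolynomial (Fin n) F) K]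
    (c : Fin n → K)
    (hc : ∀ i, c i = algebraMap (MvPolynomial (Fin n) F) K (MvPolynomial.X i))
    (p : K[X])
    (hp : p = X ^ n + ∑ i : Fin n, Polynomial.C (c i) * X ^ (n - ((i : ℕ) + 1))) :
    ∃ (L : Type) (_ : Field L) (_ : Algebra K L),
      ObtainableByAuxDegLE K L 3 ∧
      ∃ a : Fin n → L, (∃ i : Fin n, (i : ℕ) ≠ 0 ∧ a i ≠ 0) ∧
        letI M := (p.map (algebraMap K L)).SplittingField
        letI q : M[X] :=
          (((p.map (algebraMap K L)).map (algebraMap L M)).roots.map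
            (fun x => (Polynomial.X : M[X]) - Polynomial.C (∑ k : Fin n,
              algebraMap L M (a k) * x ^ (k : ℕ)))).prod
        q.coeff (n - 1) = 0 ∧ q.coeff (n - 2) = 0 ∧
          q.coeff (n - 3) = 0 := by
  have hlt : (∑ i : Fin n, C (c i) * X ^ (n - ((i : ℕ) + 1))).degree < (n : WithBot ℕ) := by
    refine (degree_sum_le _ _).trans_lt ((Finset.sup_lt_iff (WithBot.bot_lt_coe n)).mpr ?_)
    intro i _
    refine (degree_C_mul_X_pow_le _ _).trans_lt (Nat.cast_lt.mpr ?_)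
    have := i.2
    omega
  have hdeg : p.natDegree = n := by
    rw [hp]
    exact natDegree_eq_of_degree_eq_some
      ((degree_add_eq_left_of_degree_lt (by rwa [degree_X_pow])).trans (degree_X_pow n))
  have : CharZero (MvPolynomial (Fin n) F) :=
    charZero_of_injective_algebraMap (MvPolynomial.C_injective (Fin n) F)
  have : CharZero K :=
    charZero_of_injective_algebraMap (IsFractionRing.injective (MvPolynomial (Fin n) F) K)
  obtain ⟨Λ, hΛ⟩ := exists_functional_eq_sum_roots p
  obtain ⟨L, _, _, hL, f, hf0, hfdeg, hf⟩ := exists_extension_functional_pow_eq_zero Λ hn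
  refine ⟨L, inferInstance, inferInstance, hL, fun i => f.coeff i, ?_, ?_⟩
  · by_contra! hconst
    have hfC : f = C (f.coeff 0) := by
      ext k
      rw [coeff_C]
      split_ifs with hk
      · rw [hk]
      · rcases lt_or_ge k n with hkn | hkn
        · exact hconst ⟨k, hkn⟩ hk
        · exact coeff_eq_zero_of_degree_lt (hfdeg.trans_le (Nat.cast_le.mpr hkn))
    have h1 : Λ (X ^ 0) = n := by
      have hs := SplittingField.splits p
      refine (algebraMap K p.SplittingField).injective ?_
      rw [hΛ _ hs 0]
      simp [← hs.natDegree_eq_card_roots, hdeg]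
    have := hf 1 (by simp)
    rw [pow_one, hfC, ← mul_one (C _), ← pow_zero X, polynomialFunctionalExtend_C_mul_X_pow, h1,
      map_natCast, mul_eq_zero] at this
    have : CharZero L := charZero_of_injective_algebraMap (algebraMap K L).injective
    have hn0 : (n : L) ≠ 0 := Nat.cast_ne_zero.mpr (by omega)
    refine hf0 ?_
    rw [hfC, (by tauto : f.coeff 0 = 0), C_0]
  · let M := (p.map (algebraMap K L)).SplittingField
    have : CharZero M := charZero_of_injective_algebraMap (algebraMap K M).injective
    have hM : (p.map (algebraMap K M)).Splits := by
      rw [IsScalarTower.algebraMap_eq K L M, ← Polynomial.map_map]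
      exact SplittingField.splits _
    have key : ∀ k ∈ Finset.Icc 1 3, _ := fun k hk =>
      coeff_tschirnhaus_eq_zero (M := M) hdeg (by omega) hM (hΛ M hM) hfdeg hf hk
    exact ⟨key 1 (by simp), key 2 (by simp), key 3 (by simp)⟩
end
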